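/- arXiv:1407.4786 — 2 statements merged into one kernel-verified Lean document; each statement's English description precedes it below -/
import Mathlib

section
/- Möbius-invariance modulus of continuity: there is a constant C = C(n) such that for all z, w, ξ in the unit ball B_n, the pseudo-hyperbolic distance satisfies ρ(φ_z(ξ), φ_w(ξ)) ≤ C · ρ(z,w) / (1 - |ξ|²). -/
set_option autoImplicit false

noncomputable section

/-- The Euclidean norm on `ℂ^n`. -/
def nrm2 {n : ℕ} (z : Fin n → ℂ) : ℝ := Real.sqrt (∑ i, ‖z i‖ ^ 2)

/-- The pairing `⟨z, w⟩ = ∑ zᵢ conj(wᵢ)` on `ℂ^n`. -/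
def pairC {n : ℕ} (z w : Fin n → ℂ) : ℂ := ∑ i, z i * (starRingEnd ℂ) (w i)

/-- The open unit ball `B_n` of `ℂ^n`. -/
def Ball (n : ℕ) : Set (Fin n → ℂ) := {z | nrm2 z < 1}

/-- The Möbius involution `φ_z` of the unit ball interchanging `0` and `z`:
`φ_z(w) = (z - P_z w - s_z Q_z w) / (1 - ⟨w, z⟩)`, where `P_z` is the
orthogonal projection onto `ℂ z`, `Q_z = I - P_z`, and `s_z = √(1-|z|²)`. -/
def mob {n : ℕ} (z w : Fin n → ℂ) : Fin n → ℂ :=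
  if z = 0 then -w else
    (1 - pairC w z)⁻¹ •
      (z - (pairC w z / pairC z z) • z -
        ((Real.sqrt (1 - nrm2 z ^ 2) : ℝ) : ℂ) •
          (w - (pairC w z / pairC z z) • z))

section InnerProductBall

open scoped InnerProductSpace
open Complex

variable {E : Type*} [NormedAddCommGroup E]

/-- The factor `√(1 - ‖z‖²)`. -/
def defect (z : E) : ℝ := Real.sqrt (1 - ‖z‖ ^ 2)

lemma defect_nonneg (z : E) : 0 ≤ defect z := Real.sqrt_nonneg _

lemma defect_sq {z : E} (hz : ‖z‖ < 1) : defect z ^ 2 = 1 - ‖z‖ ^ 2 :=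
  Real.sq_sqrt (by nlinarith [norm_nonneg z])

lemma defect_pos {z : E} (hz : ‖z‖ < 1) : 0 < defect z :=
  Real.sqrt_pos.2 (by nlinarith [norm_nonneg z])

lemma one_add_defect_ne_zero (z : E) : (1 + defect z : ℂ) ≠ 0 := by
  have := defect_nonneg z
  exact_mod_cast (by positivity : (1 + defect z : ℝ) ≠ 0)

lemma norm_div_one_add_defect_le (z : E) (c : ℂ) : ‖c / (1 + defect z : ℂ)‖ ≤ ‖c‖ := by
  have h := defect_nonneg z
  have e : ‖(1 + defect z : ℂ)‖ = 1 + defect z := by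
    rw [← Complex.ofReal_one, ← Complex.ofReal_add, Complex.norm_real,
      Real.norm_of_nonneg (by positivity)]
  rw [norm_div, e]
  exact div_le_self (norm_nonneg _) (by linarith)

variable [InnerProductSpace ℂ E]

/-- The operator `P_z + s_z Q_z`, written without division by `‖z‖`. -/
def mobLin (z v : E) : E :=
  (defect z : ℂ) • v + (⟪z, v⟫_ℂ / (1 + defect z : ℂ)) • z

/-- The Möbius involution of the unit ball of a complex inner product space. -/
def ballMob (z v : E) : E := (1 - ⟪z, v⟫_ℂ)⁻¹ • (z - mobLin z v)

lemma inner_self_eq_ofReal (z : E) : ⟪z, z⟫_ℂ = ((‖z‖ ^ 2 : ℝ) : ℂ) := by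
  rw [inner_self_eq_norm_sq_to_K]
  simp

lemma inner_self_eq_one_sub_defect_sq {z : E} (hz : ‖z‖ < 1) :
    ⟪z, z⟫_ℂ = 1 - (defect z : ℂ) ^ 2 := by
  have h : ‖z‖ ^ 2 = 1 - defect z ^ 2 := by rw [defect_sq hz]; ring
  rw [inner_self_eq_ofReal, h]
  push_cast
  rfl

lemma norm_inner_lt_one {z v : E} (hz : ‖z‖ < 1) (hv : ‖v‖ < 1) : ‖⟪z, v⟫_ℂ‖ < 1 :=
  (norm_inner_le_norm z v).trans_lt (by nlinarith [norm_nonneg z, norm_nonneg v])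

lemma one_sub_inner_ne_zero {z v : E} (hz : ‖z‖ < 1) (hv : ‖v‖ < 1) :
    (1 - ⟪z, v⟫_ℂ) ≠ 0 := by
  intro h
  have := norm_inner_lt_one hz hv
  rw [← sub_eq_zero.1 h] at this
  simp at this

lemma norm_one_sub_inner_pos {z v : E} (hz : ‖z‖ < 1) (hv : ‖v‖ < 1) :
    0 < ‖1 - ⟪z, v⟫_ℂ‖ :=
  norm_pos_iff.2 (one_sub_inner_ne_zero hz hv)

lemma norm_one_sub_inner_comm (z w : E) : ‖1 - ⟪z, w⟫_ℂ‖ = ‖1 - ⟪w, z⟫_ℂ‖ := by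
  rw [← inner_conj_symm z w, ← Complex.norm_conj]
  simp

lemma mobLin_sub (z u v : E) : mobLin z (u - v) = mobLin z u - mobLin z v := by
  simp only [mobLin, inner_sub_right]
  module

lemma mobLin_smul (z v : E) (c : ℂ) : mobLin z (c • v) = c • mobLin z v := by
  simp only [mobLin, inner_smul_right]
  module

lemma mobLin_self {z : E} (hz : ‖z‖ < 1) : mobLin z z = z := by
  have h := one_add_defect_ne_zero z
  rw [mobLin, inner_self_eq_one_sub_defect_sq hz, ← add_smul]
  have : (defect z : ℂ) + (1 - (defect z : ℂ) ^ 2) / (1 + defect z : ℂ) = 1 := by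
    field_simp
    ring
  rw [this, one_smul]

lemma inner_mobLin_left (z u v : E) : ⟪mobLin z u, v⟫_ℂ = ⟪u, mobLin z v⟫_ℂ := by
  simp only [mobLin, inner_add_left, inner_add_right, inner_smul_left, inner_smul_right, map_div₀,
    inner_conj_symm, Complex.conj_ofReal, map_add, map_one]
  ring

lemma mobLin_mobLin {z : E} (hz : ‖z‖ < 1) (v : E) :
    mobLin z (mobLin z v) = ((defect z : ℂ) ^ 2) • v + ⟪z, v⟫_ℂ • z := by
  have h := one_add_defect_ne_zero z
  simp only [mobLin, inner_add_right, inner_smul_right, inner_self_eq_one_sub_defect_sq hz]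
  match_scalars
  · ring
  · field_simp
    ring

lemma norm_mobLin_sq {z : E} (hz : ‖z‖ < 1) (v : E) :
    ‖mobLin z v‖ ^ 2 = defect z ^ 2 * ‖v‖ ^ 2 + ‖⟪z, v⟫_ℂ‖ ^ 2 := by
  have h : ⟪mobLin z v, mobLin z v⟫_ℂ
      = (defect z : ℂ) ^ 2 * ⟪v, v⟫_ℂ + ⟪z, v⟫_ℂ * ⟪v, z⟫_ℂ := by
    rw [inner_mobLin_left, mobLin_mobLin hz, inner_add_right, inner_smul_right, inner_smul_right]
  rw [← inner_conj_symm v z, Complex.mul_conj, inner_self_eq_ofReal,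
    inner_self_eq_ofReal, Complex.normSq_eq_norm_sq] at h
  exact_mod_cast h

lemma norm_mobLin_le {z : E} (hz : ‖z‖ < 1) (v : E) : ‖mobLin z v‖ ≤ ‖v‖ := by
  refine le_of_sq_le_sq ?_ (norm_nonneg v)
  have h := pow_le_pow_left₀ (norm_nonneg _) (norm_inner_le_norm (𝕜 := ℂ) z v) 2
  rw [norm_mobLin_sq hz, defect_sq hz]
  nlinarith

lemma defect_mul_norm_le {z : E} (hz : ‖z‖ < 1) (v : E) : defect z * ‖v‖ ≤ ‖mobLin z v‖ := by
  refine le_of_sq_le_sq ?_ (norm_nonneg _)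
  rw [norm_mobLin_sq hz, mul_pow]
  nlinarith [sq_nonneg ‖⟪z, v⟫_ℂ‖]

lemma norm_sub_mobLin {z v : E} (hz : ‖z‖ < 1) (hv : ‖v‖ < 1) :
    ‖z - mobLin z v‖ = ‖ballMob z v‖ * ‖1 - ⟪z, v⟫_ℂ‖ := by
  have h := norm_one_sub_inner_pos hz hv
  rw [ballMob, norm_smul, norm_inv]
  field_simp

lemma one_sub_inner_ballMob {w a b : E} (hw : ‖w‖ < 1) (ha : ‖a‖ < 1) (hb : ‖b‖ < 1) :
    1 - ⟪ballMob w a, ballMob w b⟫_ℂ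
      = (defect w : ℂ) ^ 2 * (1 - ⟪a, b⟫_ℂ) / ((1 - ⟪a, w⟫_ℂ) * (1 - ⟪w, b⟫_ℂ)) := by
  have h1 := one_sub_inner_ne_zero ha hw
  have h2 := one_sub_inner_ne_zero hw hb
  have e : ⟪w - mobLin w a, w - mobLin w b⟫_ℂ
      = 1 - (defect w : ℂ) ^ 2 - ⟪w, b⟫_ℂ - ⟪a, w⟫_ℂ
        + ((defect w : ℂ) ^ 2 * ⟪a, b⟫_ℂ + ⟪w, b⟫_ℂ * ⟪a, w⟫_ℂ) := by
    rw [inner_sub_left, inner_sub_right, inner_sub_right, ← inner_mobLin_left w w b,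
      inner_mobLin_left w a w, mobLin_self hw, inner_mobLin_left w a, mobLin_mobLin hw,
      inner_add_right, inner_smul_right, inner_smul_right, inner_self_eq_one_sub_defect_sq hw]
    ring
  simp only [ballMob, inner_smul_left, inner_smul_right, map_inv₀, map_sub, map_one,
    inner_conj_symm, e]
  field_simp
  ring

lemma one_sub_norm_ballMob_sq {w a : E} (hw : ‖w‖ < 1) (ha : ‖a‖ < 1) :
    1 - ‖ballMob w a‖ ^ 2 = (1 - ‖w‖ ^ 2) * (1 - ‖a‖ ^ 2) / ‖1 - ⟪w, a⟫_ℂ‖ ^ 2 := by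
  have h := one_sub_inner_ballMob hw ha ha
  have e : (1 - ⟪a, w⟫_ℂ) = (starRingEnd ℂ) (1 - ⟪w, a⟫_ℂ) := by simp
  rw [e, mul_comm ((starRingEnd ℂ) _), Complex.mul_conj, inner_self_eq_ofReal,
    inner_self_eq_ofReal, Complex.normSq_eq_norm_sq] at h
  rw [← defect_sq hw]
  exact_mod_cast h

lemma norm_ballMob_lt_one {w a : E} (hw : ‖w‖ < 1) (ha : ‖a‖ < 1) : ‖ballMob w a‖ < 1 := by
  have h := one_sub_norm_ballMob_sq hw ha
  have h1 := norm_one_sub_inner_pos hw ha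
  have h2 : 0 < 1 - ‖w‖ ^ 2 := by nlinarith [norm_nonneg w]
  have h3 : 0 < 1 - ‖a‖ ^ 2 := by nlinarith [norm_nonneg a]
  have : 0 < 1 - ‖ballMob w a‖ ^ 2 := by rw [h]; positivity
  nlinarith [norm_nonneg (ballMob w a)]

lemma norm_ballMob_comm {z w : E} (hz : ‖z‖ < 1) (hw : ‖w‖ < 1) :
    ‖ballMob z w‖ = ‖ballMob w z‖ := by
  rw [← sq_eq_sq₀ (norm_nonneg _) (norm_nonneg _)]
  have h1 := one_sub_norm_ballMob_sq hz hw
  have h2 := one_sub_norm_ballMob_sq hw hz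
  rw [norm_one_sub_inner_comm, mul_comm (1 - ‖z‖ ^ 2)] at h1
  linarith

/-- The pseudo-hyperbolic metric is invariant under the Möbius involutions. -/
lemma norm_ballMob_ballMob_ballMob {w a b : E} (hw : ‖w‖ < 1) (ha : ‖a‖ < 1) (hb : ‖b‖ < 1) :
    ‖ballMob (ballMob w a) (ballMob w b)‖ = ‖ballMob a b‖ := by
  rw [← sq_eq_sq₀ (norm_nonneg _) (norm_nonneg _)]
  have h1 := one_sub_norm_ballMob_sq (norm_ballMob_lt_one hw ha) (norm_ballMob_lt_one hw hb)
  have h2 := one_sub_norm_ballMob_sq ha hb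
  have hs := (defect_pos hw).ne'
  have k1 := (norm_one_sub_inner_pos hw ha).ne'
  have k2 := (norm_one_sub_inner_pos hw hb).ne'
  have k3 := (norm_one_sub_inner_pos ha hb).ne'
  rw [one_sub_norm_ballMob_sq hw ha, one_sub_norm_ballMob_sq hw hb,
    one_sub_inner_ballMob hw ha hb, ← defect_sq hw, norm_div, norm_mul, norm_mul, norm_pow,
    Complex.norm_real, Real.norm_of_nonneg (defect_nonneg w), norm_one_sub_inner_comm a w] at h1
  have h3 : 1 - ‖ballMob (ballMob w a) (ballMob w b)‖ ^ 2 = 1 - ‖ballMob a b‖ ^ 2 := by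
    rw [h1, h2]
    field_simp
  linarith

lemma norm_ballMob_mul_le {x v : E} (hx : ‖x‖ < 1) (hv : ‖v‖ < 1) :
    ‖ballMob x v‖ * ‖1 - ⟪x, v⟫_ℂ‖ ≤ ‖x - v‖ := by
  have h := norm_mobLin_le hx (x - v)
  rwa [mobLin_sub, mobLin_self hx, norm_sub_mobLin hx hv] at h

lemma norm_ballMob_le_div {x v : E} (hx : ‖x‖ < 1) (hv : ‖v‖ < 1) :
    ‖ballMob x v‖ ≤ 2 * ‖x - v‖ / (1 - ‖v‖ ^ 2) := by
  have h := norm_ballMob_mul_le hx hv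
  have h0 := norm_nonneg v
  have h1 : 0 < 1 - ‖v‖ ^ 2 := by nlinarith
  have h2 : 1 - ‖v‖ ≤ ‖1 - ⟪x, v⟫_ℂ‖ := by
    have a := norm_sub_norm_le (1 : ℂ) ⟪x, v⟫_ℂ
    have b := norm_inner_le_norm (𝕜 := ℂ) x v
    rw [norm_one] at a
    nlinarith
  rw [le_div_iff₀ h1]
  nlinarith [mul_le_mul_of_nonneg_left h2 (norm_nonneg (ballMob x v)),
    mul_nonneg (norm_nonneg (ballMob x v)) h0,
    mul_nonneg (norm_nonneg (ballMob x v)) (mul_nonneg (sub_nonneg.2 hv.le) (sub_nonneg.2 hv.le))]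

/-- The denominator of the linear fractional map `φ_w ∘ φ_z`. -/
def compDenom (w z ξ : E) : ℂ := (1 - ⟪w, z⟫_ℂ) - ⟪z - mobLin z w, ξ⟫_ℂ

/-- The deviation of the linear part of `φ_w ∘ φ_z` from a multiple of the identity. -/
def compRem (w z ξ : E) : E :=
  mobLin w (mobLin z ξ) - ⟪z, ξ⟫_ℂ • w - (1 - ⟪w, z⟫_ℂ) • ξ

lemma compDenom_eq {w z ξ : E} (hz : ‖z‖ < 1) (hξ : ‖ξ‖ < 1) :
    compDenom w z ξ = (1 - ⟪z, ξ⟫_ℂ) * (1 - ⟪w, ballMob z ξ⟫_ℂ) := by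
  have h := one_sub_inner_ne_zero hz hξ
  rw [compDenom, ballMob, inner_smul_right, inner_sub_left, inner_mobLin_left, inner_sub_right]
  field_simp
  ring

lemma compDenom_smul_ballMob_sub {w z ξ : E} (hw : ‖w‖ < 1) (hz : ‖z‖ < 1) (hξ : ‖ξ‖ < 1) :
    compDenom w z ξ • (ballMob w (ballMob z ξ) - ξ)
      = (w - mobLin w z) + compRem w z ξ + ⟪z - mobLin z w, ξ⟫_ℂ • ξ := by
  have h1 := one_sub_inner_ne_zero hz hξ
  have h2 := one_sub_inner_ne_zero hw (norm_ballMob_lt_one hz hξ)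
  have e : compDenom w z ξ • ballMob w (ballMob z ξ)
      = (1 - ⟪z, ξ⟫_ℂ) • w - (mobLin w z - mobLin w (mobLin z ξ)) := by
    rw [compDenom_eq hz hξ, ballMob.eq_def w, smul_smul, mul_assoc, mul_inv_cancel₀ h2, mul_one,
      ballMob, mobLin_smul, mobLin_sub, smul_sub, smul_smul, mul_inv_cancel₀ h1, one_smul]
  rw [smul_sub, e, compDenom, compRem]
  module

lemma compRem_eq (w z ξ : E) :
    compRem w z ξ = ((defect z : ℂ) * defect w - (1 - ⟪w, z⟫_ℂ)) • ξ
      + (⟪z, ξ⟫_ℂ / (1 + defect z)) • ((defect w : ℂ) • (z - w))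
      + (⟪(defect z : ℂ) • (w - z), ξ⟫_ℂ / (1 + defect w)) • w
      + ((((defect w : ℂ) ^ 2 - (1 - ⟪w, z⟫_ℂ)) + ((defect z : ℂ) ^ 2 - defect z * defect w))
          / ((1 + defect z) * (1 + defect w)) * ⟪z, ξ⟫_ℂ) • w := by
  have h1 := one_add_defect_ne_zero z
  have h2 := one_add_defect_ne_zero w
  simp only [compRem, mobLin, inner_add_right, inner_smul_right, inner_smul_left, inner_sub_left,
    Complex.conj_ofReal]
  match_scalars
  · ring
  · field_simp
  · field_simp
    ring

lemma norm_compRem_le {w z ξ : E} (hw : ‖w‖ < 1) (hz : ‖z‖ < 1) (hξ : ‖ξ‖ < 1) :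
    ‖compRem w z ξ‖ ≤ 8 * (‖ballMob z w‖ * ‖1 - ⟪w, z⟫_ℂ‖) := by
  set q := ‖ballMob z w‖ * ‖1 - ⟪w, z⟫_ℂ‖ with hq
  have nz : ‖z - mobLin z w‖ = q := by
    rw [norm_sub_mobLin hz hw, norm_one_sub_inner_comm]
  have nw : ‖w - mobLin w z‖ = q := by
    rw [norm_sub_mobLin hw hz, norm_ballMob_comm hw hz]
  have hz' : mobLin z (z - w) = z - mobLin z w := by rw [mobLin_sub, mobLin_self hz]
  have hw' : mobLin w (z - w) = -(w - mobLin w z) := by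
    rw [mobLin_sub, mobLin_self hw]; abel
  have q0 : 0 ≤ q := by positivity
  have sz := defect_nonneg z
  have sw := defect_nonneg w
  have dz : defect z * ‖w - z‖ ≤ q := by
    rw [← nz, ← hz', norm_sub_rev]; exact defect_mul_norm_le hz _
  have dw : defect w * ‖z - w‖ ≤ q := by
    rw [← nw, ← norm_neg (w - _), ← hw']; exact defect_mul_norm_le hw _
  have az : ‖(defect z : ℂ) ^ 2 - (1 - ⟪w, z⟫_ℂ)‖ ≤ q := by
    have e : (defect z : ℂ) ^ 2 - (1 - ⟪w, z⟫_ℂ) = -⟪z - mobLin z w, z⟫_ℂ := by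
      rw [inner_sub_left, inner_mobLin_left, mobLin_self hz, inner_self_eq_one_sub_defect_sq hz]
      ring
    rw [e, norm_neg]
    refine (norm_inner_le_norm _ _).trans ?_
    rw [nz]
    nlinarith
  have aw : ‖(defect w : ℂ) ^ 2 - (1 - ⟪w, z⟫_ℂ)‖ ≤ q := by
    have e : (defect w : ℂ) ^ 2 - (1 - ⟪w, z⟫_ℂ) = -⟪w, w - mobLin w z⟫_ℂ := by
      rw [inner_sub_right, ← inner_mobLin_left, mobLin_self hw,
        inner_self_eq_one_sub_defect_sq hw]
      ring
    rw [e, norm_neg]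
    refine (norm_inner_le_norm _ _).trans ?_
    rw [nw]
    nlinarith
  have ds : ‖(defect z : ℂ) ^ 2 - defect z * defect w‖ ≤ 2 * q := by
    have h1 : |defect z ^ 2 - defect w ^ 2| ≤ 2 * q := by
      have := norm_sub_le ((defect z : ℂ) ^ 2 - (1 - ⟪w, z⟫_ℂ))
        ((defect w : ℂ) ^ 2 - (1 - ⟪w, z⟫_ℂ))
      rw [sub_sub_sub_cancel_right] at this
      have e : ‖(defect z : ℂ) ^ 2 - (defect w : ℂ) ^ 2‖ = |defect z ^ 2 - defect w ^ 2| := by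
        rw [← Real.norm_eq_abs, ← Complex.norm_real]; push_cast; rfl
      rw [e] at this
      linarith
    have e : ‖(defect z : ℂ) ^ 2 - defect z * defect w‖ = |defect z - defect w| * defect z := by
      have e' : (defect z : ℂ) ^ 2 - defect z * defect w
          = (((defect z - defect w) * defect z : ℝ) : ℂ) := by
        push_cast
        ring
      rw [e', Complex.norm_real, Real.norm_eq_abs, abs_mul, abs_of_nonneg sz]
    rw [e]
    rw [sq_sub_sq, abs_mul, abs_of_nonneg (by positivity : 0 ≤ defect z + defect w)] at h1
    nlinarith [mul_nonneg (abs_nonneg (defect z - defect w)) sw]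
  have iz : ‖⟪z, ξ⟫_ℂ‖ ≤ 1 := (norm_inner_lt_one hz hξ).le
  have b1 : ‖((defect z : ℂ) * defect w - (1 - ⟪w, z⟫_ℂ)) • ξ‖ ≤ 3 * q := by
    have := norm_sub_le ((defect z : ℂ) ^ 2 - (1 - ⟪w, z⟫_ℂ))
      ((defect z : ℂ) ^ 2 - defect z * defect w)
    rw [sub_sub_sub_cancel_left] at this
    rw [norm_smul]
    nlinarith [norm_nonneg ((defect z : ℂ) * defect w - (1 - ⟪w, z⟫_ℂ))]
  have b2 : ‖(⟪z, ξ⟫_ℂ / (1 + defect z)) • ((defect w : ℂ) • (z - w))‖ ≤ q := by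
    rw [norm_smul, norm_smul, Complex.norm_real, Real.norm_of_nonneg sw]
    have := (norm_div_one_add_defect_le z ⟪z, ξ⟫_ℂ).trans iz
    nlinarith [mul_nonneg sw (norm_nonneg (z - w))]
  have b3 : ‖(⟪(defect z : ℂ) • (w - z), ξ⟫_ℂ / (1 + defect w)) • w‖ ≤ q := by
    have h1 := (norm_div_one_add_defect_le w ⟪(defect z : ℂ) • (w - z), ξ⟫_ℂ).trans
      (norm_inner_le_norm _ _)
    rw [norm_smul (defect z : ℂ), Complex.norm_real, Real.norm_of_nonneg sz] at h1
    rw [norm_smul]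
    have h2 : ‖⟪(defect z : ℂ) • (w - z), ξ⟫_ℂ / (1 + defect w : ℂ)‖ ≤ q :=
      h1.trans (by nlinarith [mul_nonneg sz (norm_nonneg (w - z))])
    nlinarith [norm_nonneg w]
  have b4 : ‖((((defect w : ℂ) ^ 2 - (1 - ⟪w, z⟫_ℂ)) + ((defect z : ℂ) ^ 2 - defect z * defect w))
          / ((1 + defect z) * (1 + defect w)) * ⟪z, ξ⟫_ℂ) • w‖ ≤ 3 * q := by
    rw [norm_smul, norm_mul, ← div_div]
    have h1 := (norm_div_one_add_defect_le w _).trans ((norm_div_one_add_defect_le z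
      (((defect w : ℂ) ^ 2 - (1 - ⟪w, z⟫_ℂ)) + ((defect z : ℂ) ^ 2 - defect z * defect w))).trans
      ((norm_add_le _ _).trans (add_le_add aw ds)))
    calc _ ≤ (q + 2 * q) * 1 * 1 := by gcongr
      _ = 3 * q := by ring
  rw [compRem_eq]
  refine (norm_add_le _ _).trans ?_
  refine (add_le_add ((norm_add_le _ _).trans (add_le_add (norm_add_le _ _) le_rfl))
    le_rfl).trans ?_
  linarith

/-- `φ_w ∘ φ_z` is uniformly close to the identity when `z` and `w` are close. -/
lemma norm_ballMob_ballMob_sub_le {w z ξ : E} (hw : ‖w‖ < 1) (hz : ‖z‖ < 1) (hξ : ‖ξ‖ < 1)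
    (h : ‖ballMob z w‖ ≤ 1 / 2) :
    ‖ballMob w (ballMob z ξ) - ξ‖ ≤ 20 * ‖ballMob z w‖ := by
  have ht := norm_one_sub_inner_pos hw hz
  have nz : ‖z - mobLin z w‖ = ‖ballMob z w‖ * ‖1 - ⟪w, z⟫_ℂ‖ := by
    rw [norm_sub_mobLin hz hw, norm_one_sub_inner_comm]
  have nw : ‖w - mobLin w z‖ = ‖ballMob z w‖ * ‖1 - ⟪w, z⟫_ℂ‖ := by
    rw [norm_sub_mobLin hw hz, norm_ballMob_comm hw hz]
  have hi : ‖⟪z - mobLin z w, ξ⟫_ℂ‖ ≤ ‖ballMob z w‖ * ‖1 - ⟪w, z⟫_ℂ‖ := by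
    rw [← nz]
    exact (norm_inner_le_norm _ _).trans (mul_le_of_le_one_right (norm_nonneg _) hξ.le)
  have hD : ‖1 - ⟪w, z⟫_ℂ‖ / 2 ≤ ‖compDenom w z ξ‖ := by
    have := norm_sub_norm_le (1 - ⟪w, z⟫_ℂ) ⟪z - mobLin z w, ξ⟫_ℂ
    rw [compDenom]
    nlinarith
  have hn : ‖compDenom w z ξ‖ * ‖ballMob w (ballMob z ξ) - ξ‖
      ≤ 10 * (‖ballMob z w‖ * ‖1 - ⟪w, z⟫_ℂ‖) := by
    rw [← norm_smul, compDenom_smul_ballMob_sub hw hz hξ]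
    refine (norm_add_le _ _).trans ?_
    have h1 := norm_add_le (w - mobLin w z) (compRem w z ξ)
    have h2 := norm_compRem_le hw hz hξ
    have h3 : ‖⟪z - mobLin z w, ξ⟫_ℂ • ξ‖ ≤ ‖ballMob z w‖ * ‖1 - ⟪w, z⟫_ℂ‖ := by
      rw [norm_smul]
      exact (mul_le_of_le_one_right (norm_nonneg _) hξ.le).trans hi
    linarith
  refine le_of_mul_le_mul_left ?_ (half_pos ht)
  nlinarith [mul_le_mul_of_nonneg_right hD (norm_nonneg (ballMob w (ballMob z ξ) - ξ))]

lemma ballMob_ballMob {w ξ : E} (hw : ‖w‖ < 1) (hξ : ‖ξ‖ < 1) :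
    ballMob w (ballMob w ξ) = ξ := by
  have h : ballMob w w = 0 := by rw [ballMob, mobLin_self hw, sub_self, smul_zero]
  have := norm_ballMob_ballMob_sub_le hw hw hξ (by rw [h, norm_zero]; norm_num)
  rw [h, norm_zero, mul_zero] at this
  exact sub_eq_zero.1 (norm_le_zero_iff.1 this)

theorem norm_ballMob_ballMob_le {z w ξ : E} (hz : ‖z‖ < 1) (hw : ‖w‖ < 1) (hξ : ‖ξ‖ < 1) :
    ‖ballMob (ballMob z ξ) (ballMob w ξ)‖ ≤ 40 * ‖ballMob z w‖ / (1 - ‖ξ‖ ^ 2) := by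
  have h1 : 0 < 1 - ‖ξ‖ ^ 2 := by nlinarith [norm_nonneg ξ]
  have hzξ := norm_ballMob_lt_one hz hξ
  have hwξ := norm_ballMob_lt_one hw hξ
  rcases le_or_gt ‖ballMob z w‖ (1 / 2) with h | h
  · rw [← norm_ballMob_ballMob_ballMob hw hzξ hwξ, ballMob_ballMob hw hξ]
    refine (norm_ballMob_le_div (norm_ballMob_lt_one hw hzξ) hξ).trans ?_
    have := norm_ballMob_ballMob_sub_le hw hz hξ h
    exact div_le_div_of_nonneg_right (by linarith) h1.le
  · refine (norm_ballMob_lt_one hzξ hwξ).le.trans ?_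
    rw [le_div_iff₀ h1]
    nlinarith [sq_nonneg ‖ξ‖]

end InnerProductBall

section Coordinates

variable {n : ℕ}

lemma nrm2_eq_norm_toLp (z : Fin n → ℂ) : nrm2 z = ‖WithLp.toLp 2 z‖ := by
  rw [EuclideanSpace.norm_eq]
  rfl

lemma pairC_eq_inner_toLp (z w : Fin n → ℂ) :
    pairC z w = inner ℂ (WithLp.toLp 2 w) (WithLp.toLp 2 z) := by
  simp [pairC, PiLp.inner_apply]

lemma toLp_mob {z : Fin n → ℂ} (hz : z ∈ Ball n) (w : Fin n → ℂ) :
    WithLp.toLp 2 (mob z w) = ballMob (WithLp.toLp 2 z) (WithLp.toLp 2 w) := by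
  by_cases h : z = 0
  · subst h
    simp [mob, ballMob, mobLin, defect]
  · have hz' : ‖WithLp.toLp 2 z‖ < 1 := by rw [← nrm2_eq_norm_toLp]; exact hz
    have hs := one_add_defect_ne_zero (WithLp.toLp 2 z)
    have hzz : inner ℂ (WithLp.toLp 2 z) (WithLp.toLp 2 z) ≠ 0 := by
      simpa using h
    have hd : Real.sqrt (1 - nrm2 z ^ 2) = defect (WithLp.toLp 2 z) := by
      rw [nrm2_eq_norm_toLp]; rfl
    rw [mob, if_neg h, hd, pairC_eq_inner_toLp, pairC_eq_inner_toLp]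
    simp only [WithLp.toLp_smul, WithLp.toLp_sub]
    rw [ballMob, mobLin]
    rw [inner_self_eq_one_sub_defect_sq hz'] at hzz ⊢
    congr 1
    match_scalars
    · field_simp
      ring
    · ring

end Coordinates

/-- Möbius-invariance modulus of continuity: there is a constant `C = C(n)`
such that for all `z, w, ξ` in the unit ball, the pseudo-hyperbolic distance
satisfies `ρ(φ_z(ξ), φ_w(ξ)) ≤ C ρ(z,w)/(1-|ξ|²)`, where `ρ(a,b) = |φ_a(b)|`. -/
theorem mobius_invariance_modulus (n : ℕ) :
    ∃ C : ℝ, 0 < C ∧ ∀ z ∈ Ball n, ∀ w ∈ Ball n, ∀ ξ ∈ Ball n,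
      nrm2 (mob (mob z ξ) (mob w ξ)) ≤ C * nrm2 (mob z w) / (1 - nrm2 ξ ^ 2) := by
  refine ⟨40, by norm_num, fun z hz w hw ξ hξ => ?_⟩
  have mem : ∀ {v : Fin n → ℂ}, v ∈ Ball n ↔ ‖WithLp.toLp 2 v‖ < 1 := by
    intro v
    rw [← nrm2_eq_norm_toLp]
    rfl
  have hzξ : mob z ξ ∈ Ball n := by
    rw [mem, toLp_mob hz]
    exact norm_ballMob_lt_one (mem.1 hz) (mem.1 hξ)
  rw [nrm2_eq_norm_toLp, nrm2_eq_norm_toLp, nrm2_eq_norm_toLp, toLp_mob hzξ, toLp_mob hz,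
    toLp_mob hw, toLp_mob hz]
  exact norm_ballMob_ballMob_le (mem.1 hz) (mem.1 hw) (mem.1 hξ)
end
end

section
/- Rank-one factorization through Toeplitz operators: on the vector-valued Bergman space, for polynomials f ∈ A^p_α(B_n;ℂ^d) and g ∈ A^q_α(B_n;ℂ^d), the rank-one operator (f⊗g)(h) = ⟨h,g⟩_{A²_α} f equals T_{f̃} ∘ (𝟏⊗𝟏) ∘ T_{g̃*}, where f̃ denotes the diagonal matrix-valued function with f on the diagonal, g̃* its conjugate-transpose analog for g, and 𝟏 ∈ ℂ^d is the all-ones vector. Moreover, 𝟏⊗𝟏 = T_{δ₀W}, the Toeplitz operator with symbol the point mass at 0 times the all-ones matrix W. -/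
set_option autoImplicit false

open MeasureTheory

noncomputable section

/-- The inner product `⟨v, w⟩ = ∑ vᵢ conj(wᵢ)` on `ℂ^d`. -/
def einner {d : ℕ} (v w : Fin d → ℂ) : ℂ := ∑ i, v i * (starRingEnd ℂ) (w i)

/-- The `p`-th power of the `p`-norm on `ℂ^d`. -/
def pnormP {d : ℕ} (p : ℝ) (v : Fin d → ℂ) : ℝ := ∑ i, ‖v i‖ ^ p

/-- The weighted measure `dv_α = c_α (1-|z|²)^α dV` on the unit ball. -/
def wBergman (n : ℕ) (α cα : ℝ) : Measure (Fin n → ℂ) :=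
  (volume.restrict (Ball n)).withDensity
    fun z => ENNReal.ofReal (cα * (1 - nrm2 z ^ 2) ^ α)

/-- Membership in the Bergman space `A^p_α(B_n; ℂ^d)`. -/
def MemAp (n d : ℕ) (α p cα : ℝ) (f : (Fin n → ℂ) → Fin d → ℂ) : Prop :=
  DifferentiableOn ℂ f (Ball n) ∧
    Integrable (fun z => pnormP p (f z)) (wBergman n α cα)

/-- The Bergman projection
`P_α F(z) = ∫ F(w) (1-⟨z,w⟩)^{-(n+1+α)} dv_α(w)`. -/
def Bproj {n d : ℕ} (α cα : ℝ) (F : (Fin n → ℂ) → Fin d → ℂ) :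
    (Fin n → ℂ) → Fin d → ℂ :=
  fun z => ∫ w, ((1 - pairC z w) ^ (((n + 1 + α : ℝ)) : ℂ))⁻¹ • F w
    ∂(wBergman n α cα)

/-- The Toeplitz operator `T_a = P_α M_a` with matrix-valued symbol `a`. -/
def ToepSym {n d : ℕ} (α cα : ℝ)
    (a : (Fin n → ℂ) → Matrix (Fin d) (Fin d) ℂ)
    (f : (Fin n → ℂ) → Fin d → ℂ) : (Fin n → ℂ) → Fin d → ℂ :=
  Bproj α cα (fun w => (a w).mulVec (f w))

/-- `f : ℂ^n → ℂ^d` is a (vector of) polynomial(s). -/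
def IsPolyMap {n d : ℕ} (f : (Fin n → ℂ) → Fin d → ℂ) : Prop :=
  ∀ i, ∃ P : MvPolynomial (Fin n) ℂ, ∀ z, f z i = MvPolynomial.eval z P

/-- The all-ones vector `𝟏 ∈ ℂ^d`. -/
def onesV (d : ℕ) : Fin d → ℂ := fun _ => 1

/-- The rank-one operator `𝟏 ⊗ 𝟏` on the Bergman space:
`(𝟏⊗𝟏)(h) = ⟨h, 𝟏⟩_{A²_α} 𝟏`. -/
def oneTensorOne (n d : ℕ) (α cα : ℝ) (h : (Fin n → ℂ) → Fin d → ℂ) :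
    (Fin n → ℂ) → Fin d → ℂ :=
  fun _ => (∫ w, einner (h w) (onesV d) ∂(wBergman n α cα)) • onesV d

lemma nrm2_sq {n : ℕ} (z : Fin n → ℂ) : nrm2 z ^ 2 = ∑ i, ‖z i‖ ^ 2 :=
  Real.sq_sqrt (Finset.sum_nonneg fun _ _ => sq_nonneg _)

lemma nrm2_nonneg {n : ℕ} (z : Fin n → ℂ) : 0 ≤ nrm2 z := Real.sqrt_nonneg _

lemma continuous_nrm2 {n : ℕ} : Continuous (nrm2 : (Fin n → ℂ) → ℝ) := by
  unfold nrm2; fun_prop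

lemma isOpen_Ball (n : ℕ) : IsOpen (Ball n) :=
  isOpen_lt continuous_nrm2 continuous_const

lemma measurableSet_Ball (n : ℕ) : MeasurableSet (Ball n) := (isOpen_Ball n).measurableSet

lemma mem_Ball_iff {n : ℕ} (z : Fin n → ℂ) : z ∈ Ball n ↔ nrm2 z ^ 2 < 1 := by
  simp [Ball, sq_lt_one_iff₀ (nrm2_nonneg z)]

lemma nrm2_smul_sq {n : ℕ} (c : ℝ) (z : Fin n → ℂ) : nrm2 (c • z) ^ 2 = c ^ 2 * nrm2 z ^ 2 := by
  simp [nrm2_sq, Finset.mul_sum, mul_pow]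

/-- The squared modulus of the monomial `z ^ a`. -/
def absMonoSq {n : ℕ} (a : Fin n → ℕ) (z : Fin n → ℂ) : ℝ := ∏ i, ‖z i‖ ^ (2 * a i)

lemma absMonoSq_nonneg {n : ℕ} (a : Fin n → ℕ) (z : Fin n → ℂ) : 0 ≤ absMonoSq a z :=
  Finset.prod_nonneg fun _ _ => by positivity

lemma continuous_absMonoSq {n : ℕ} (a : Fin n → ℕ) : Continuous (absMonoSq a) := by
  unfold absMonoSq; fun_prop

lemma absMonoSq_smul {n : ℕ} (a : Fin n → ℕ) (c : ℝ) (z : Fin n → ℂ) :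
    absMonoSq a (c • z) = (c ^ 2) ^ (∑ i, a i) * absMonoSq a z := by
  simp [absMonoSq, mul_pow, Finset.prod_mul_distrib, pow_mul, Finset.prod_pow_eq_pow_sum]

lemma lintegral_rpow_mul_exp_neg {α : ℝ} (hα : -1 < α) :
    ∫⁻ t in Set.Ioi (0 : ℝ), ENNReal.ofReal (Real.exp (-t) * t ^ α) =
      ENNReal.ofReal (Real.Gamma (α + 1)) := by
  rw [Real.Gamma_eq_integral (by linarith), ofReal_integral_eq_lintegral_ofReal]
  · simp
  · exact Real.GammaIntegral_convergent (by linarith)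
  · refine (ae_restrict_iff' measurableSet_Ioi).2 (Filter.Eventually.of_forall fun t ht => ?_)
    have : (0 : ℝ) < t := ht
    positivity

lemma integrable_norm_pow_mul_exp (k : ℕ) :
    Integrable (fun z : ℂ => ‖z‖ ^ (2 * k) * Real.exp (-‖z‖ ^ 2)) := by
  have := Complex.integral_rpow_mul_exp_neg_rpow (p := 2) (q := 2 * k) (by norm_num)
    (by have : (0 : ℝ) ≤ k := by positivity
        linarith)
  by_contra h
  have h0 := integral_undef h
  have : ∫ x : ℂ, ‖x‖ ^ (2 * k) * Real.exp (-‖x‖ ^ 2) = 2 * Real.pi / 2 * Real.Gamma ((2 * k + 2) / 2) := by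
    rw [← this]
    congr with x
    norm_cast
  rw [h0] at this
  have : 0 < 2 * Real.pi / 2 * Real.Gamma ((2 * k + 2) / 2) := by
    have : 0 < Real.Gamma ((2 * k + 2) / 2) := Real.Gamma_pos_of_pos (by positivity)
    positivity
  linarith

lemma integral_norm_pow_mul_exp (k : ℕ) :
    ∫ z : ℂ, ‖z‖ ^ (2 * k) * Real.exp (-‖z‖ ^ 2) = Real.pi * k.factorial := by
  have := Complex.integral_rpow_mul_exp_neg_rpow (p := 2) (q := 2 * k) (by norm_num)
    (by have : (0 : ℝ) ≤ k := by positivity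
        linarith)
  have h2 : ∫ x : ℂ, ‖x‖ ^ (2 * k) * Real.exp (-‖x‖ ^ 2) = 2 * Real.pi / 2 * Real.Gamma ((2 * k + 2) / 2) := by
    rw [← this]
    congr with x
    norm_cast
  rw [h2, show ((2 * k + 2) / 2 : ℝ) = k + 1 by ring, Real.Gamma_nat_eq_factorial]
  ring

lemma lintegral_absMonoSq_mul_exp {n : ℕ} (a : Fin n → ℕ) :
    ∫⁻ z : Fin n → ℂ, ENNReal.ofReal (absMonoSq a z * Real.exp (-nrm2 z ^ 2)) =
      ENNReal.ofReal (Real.pi ^ n * ∏ i, ((a i).factorial : ℝ)) := by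
  have h : (fun z : Fin n → ℂ => absMonoSq a z * Real.exp (-nrm2 z ^ 2)) =
      fun z => ∏ i, (‖z i‖ ^ (2 * a i) * Real.exp (-‖z i‖ ^ 2)) := by
    ext z
    rw [absMonoSq, Finset.prod_mul_distrib, nrm2_sq, ← Real.exp_sum, Finset.sum_neg_distrib]
  rw [← ofReal_integral_eq_lintegral_ofReal, h]
  · congr 1
    rw [integral_fintype_prod_volume_eq_prod
      (f := fun i (z : ℂ) => ‖z‖ ^ (2 * a i) * Real.exp (-‖z‖ ^ 2))]
    simp [integral_norm_pow_mul_exp, Finset.prod_mul_distrib]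
  · rw [h]
    exact Integrable.fintype_prod
      (f := fun i (z : ℂ) => ‖z‖ ^ (2 * a i) * Real.exp (-‖z‖ ^ 2))
      fun i => integrable_norm_pow_mul_exp (a i)
  · exact Filter.Eventually.of_forall fun z => mul_nonneg (absMonoSq_nonneg a z) (by positivity)

lemma lintegral_comp_smul {n : ℕ} (F : (Fin n → ℂ) → ENNReal) (hF : Measurable F) {r : ℝ}
    (hr : 0 < r) :
    ∫⁻ z, F z = ENNReal.ofReal (r ^ (2 * n)) * ∫⁻ z, F (r • z) := by
  have h := Measure.map_addHaar_smul (volume : Measure (Fin n → ℂ)) hr.ne'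
  have hfin : Module.finrank ℝ (Fin n → ℂ) = 2 * n := by
    rw [Module.finrank_pi_fintype]; simp [mul_comm]
  have h2 : ∫⁻ z, F (r • z) = ENNReal.ofReal ((r ^ (2 * n))⁻¹) * ∫⁻ z, F z := by
    rw [← lintegral_map hF (by fun_prop), h, lintegral_smul_measure, hfin,
      abs_of_nonneg (by positivity), smul_eq_mul]
  rw [h2, ← mul_assoc, ← ENNReal.ofReal_mul (by positivity), mul_inv_cancel₀ (by positivity)]
  simp

/-- The moments of the unnormalised weighted measure on the ball. -/
lemma lintegral_Ball_absMonoSq {n : ℕ} {α : ℝ} (hα : -1 < α) (a : Fin n → ℕ) :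
    ENNReal.ofReal (Real.Gamma (n + 1 + α + ∑ i, (a i : ℝ))) *
      ∫⁻ z in Ball n, ENNReal.ofReal (absMonoSq a z * (1 - nrm2 z ^ 2) ^ α) =
    ENNReal.ofReal (Real.pi ^ n * (∏ i, ((a i).factorial : ℝ)) * Real.Gamma (α + 1)) := by
  set L := ∫⁻ z in Ball n, ENNReal.ofReal (absMonoSq a z * (1 - nrm2 z ^ 2) ^ α) with hL
  let ψ : (Fin n → ℂ) → ℝ → ENNReal := fun z r =>
    if nrm2 z ^ 2 < r then
      ENNReal.ofReal (absMonoSq a z * (Real.exp (-r) * (r - nrm2 z ^ 2) ^ α)) else 0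
  have mN : Measurable (fun x : (Fin n → ℂ) × ℝ => nrm2 x.1 ^ 2) :=
    ((continuous_nrm2.comp continuous_fst).pow 2).measurable
  have mA : Measurable (fun x : (Fin n → ℂ) × ℝ => absMonoSq a x.1) :=
    ((continuous_absMonoSq a).comp continuous_fst).measurable
  have hψ : Measurable (Function.uncurry ψ) := by
    refine Measurable.ite (measurableSet_lt mN measurable_snd) ?_ measurable_const
    exact (mA.mul ((Real.measurable_exp.comp measurable_snd.neg).mul
      ((measurable_snd.sub mN).pow_const α))).ennreal_ofReal
  have h1 : ∀ z, ∫⁻ r, ψ z r = ENNReal.ofReal (absMonoSq a z * Real.exp (-nrm2 z ^ 2)) *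
      ENNReal.ofReal (Real.Gamma (α + 1)) := by
    intro z
    rw [← lintegral_add_right_eq_self _ (nrm2 z ^ 2), ← lintegral_rpow_mul_exp_neg hα,
      ← lintegral_const_mul' _ _ ENNReal.ofReal_ne_top, ← lintegral_indicator measurableSet_Ioi]
    congr with t
    simp only [ψ, Set.indicator, Set.mem_Ioi, lt_add_iff_pos_left, add_sub_cancel_right]
    split_ifs with ht
    · rw [← ENNReal.ofReal_mul (mul_nonneg (absMonoSq_nonneg a z) (by positivity)), neg_add,
        Real.exp_add]
      congr 1; ring
    · rfl
  have h2 : ∀ r, ∫⁻ z, ψ z r = (Set.Ioi (0:ℝ)).indicator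
      (fun r => ENNReal.ofReal (Real.exp (-r) * r ^ (n + α + ∑ i, (a i : ℝ))) * L) r := by
    intro r
    by_cases hr : 0 < r
    · rw [Set.indicator_of_mem (by exact hr), lintegral_comp_smul _ _ (Real.sqrt_pos.2 hr), hL,
        ← lintegral_indicator (measurableSet_Ball n), ← lintegral_const_mul' _ _ ENNReal.ofReal_ne_top,
        ← lintegral_const_mul' _ _ ENNReal.ofReal_ne_top]
      · congr with z
        have hlt : nrm2 (Real.sqrt r • z) ^ 2 < r ↔ z ∈ Ball n := by
          rw [nrm2_smul_sq, Real.sq_sqrt hr.le, mem_Ball_iff, mul_lt_iff_lt_one_right hr]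
        by_cases hz : z ∈ Ball n
        · simp only [ψ]
          rw [if_pos (hlt.2 hz), Set.indicator_of_mem hz, nrm2_smul_sq, absMonoSq_smul,
            Real.sq_sqrt hr.le]
          rw [mem_Ball_iff] at hz
          rw [← ENNReal.ofReal_mul (by positivity), ← ENNReal.ofReal_mul (by positivity)]
          congr 1
          rw [show r - r * nrm2 z ^ 2 = r * (1 - nrm2 z ^ 2) by ring,
            Real.mul_rpow hr.le (by linarith), Real.rpow_add hr, Real.rpow_add hr, pow_mul,
            Real.sq_sqrt hr.le, Real.rpow_natCast, ← Nat.cast_sum, Real.rpow_natCast]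
          ring
        · simp only [ψ]
          rw [if_neg (mt hlt.1 hz), Set.indicator_of_notMem hz, mul_zero, mul_zero]
      · exact hψ.of_uncurry_right
    · rw [Set.indicator_of_notMem (by exact hr)]
      have : ∀ z, ψ z r = 0 := fun z => by
        simp only [ψ]
        rw [if_neg]
        have := sq_nonneg (nrm2 z)
        linarith
      simp [this]
  have h3 : ∫⁻ z, ∫⁻ r, ψ z r = ∫⁻ r, ∫⁻ z, ψ z r := lintegral_lintegral_swap hψ.aemeasurable
  simp_rw [h1, h2] at h3
  have hs : (0:ℝ) ≤ ∑ i, (a i : ℝ) := by positivity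
  have hn : (0:ℝ) ≤ n := by positivity
  rw [lintegral_mul_const' _ _ ENNReal.ofReal_ne_top, lintegral_absMonoSq_mul_exp,
    lintegral_indicator measurableSet_Ioi, lintegral_mul_const _ (by fun_prop),
    lintegral_rpow_mul_exp_neg (by linarith),
    ← ENNReal.ofReal_mul (by positivity)] at h3
  rw [h3]
  congr 3
  ring

lemma measurable_wBergman_density (n : ℕ) (α cα : ℝ) :
    Measurable fun z : Fin n → ℂ => ENNReal.ofReal (cα * (1 - nrm2 z ^ 2) ^ α) :=
  ((((continuous_nrm2.pow 2).measurable.const_sub 1).pow_const α).const_mul cα).ennreal_ofReal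

lemma ae_mem_Ball (n : ℕ) (α cα : ℝ) : ∀ᵐ z ∂(wBergman n α cα), z ∈ Ball n :=
  (withDensity_absolutelyContinuous _ _).ae_le (ae_restrict_mem (measurableSet_Ball n))

lemma lintegral_wBergman {n : ℕ} {α cα : ℝ} (hcα : 0 < cα) {F : (Fin n → ℂ) → ℝ}
    (hF : Measurable F) (hF0 : ∀ z, 0 ≤ F z) :
    ∫⁻ z, ENNReal.ofReal (F z) ∂(wBergman n α cα) =
      ENNReal.ofReal cα * ∫⁻ z in Ball n, ENNReal.ofReal (F z * (1 - nrm2 z ^ 2) ^ α) := by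
  rw [wBergman, lintegral_withDensity_eq_lintegral_mul _ (measurable_wBergman_density n α cα)
    hF.ennreal_ofReal, ← lintegral_const_mul' _ _ ENNReal.ofReal_ne_top]
  congr with z
  rw [Pi.mul_apply, ENNReal.ofReal_mul hcα.le, ENNReal.ofReal_mul (hF0 z)]
  ring

/-- The ratio `∫ |⟨z, w⟩|^{2k} dv_α(w) / |z|^{2k}`. -/
def momentCoeff (s : ℝ) (k : ℕ) : ℝ := k.factorial * Real.Gamma s / Real.Gamma (s + k)

lemma lintegral_absMonoSq_wBergman {n : ℕ} {α cα : ℝ} (hα : -1 < α) (hcα : 0 < cα)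
    (hprob : wBergman n α cα Set.univ = 1) (a : Fin n → ℕ) :
    ∫⁻ z, ENNReal.ofReal (absMonoSq a z) ∂(wBergman n α cα) =
      ENNReal.ofReal ((∏ i, ((a i).factorial : ℝ)) * Real.Gamma (n + 1 + α) /
        Real.Gamma (n + 1 + α + ∑ i, (a i : ℝ))) := by
  have hs : 0 < (n : ℝ) + 1 + α := by
    have : (0 : ℝ) ≤ n := by positivity
    linarith
  have hG : 0 < Real.Gamma (n + 1 + α) := Real.Gamma_pos_of_pos hs
  have hGα : 0 < Real.Gamma (α + 1) := Real.Gamma_pos_of_pos (by linarith)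
  have hGa : 0 < Real.Gamma (n + 1 + α + ∑ i, (a i : ℝ)) :=
    Real.Gamma_pos_of_pos (by positivity)
  have h0 := lintegral_Ball_absMonoSq hα (0 : Fin n → ℕ)
  have h1 := lintegral_Ball_absMonoSq hα a
  have hp : ENNReal.ofReal cα *
      ∫⁻ z in Ball n, ENNReal.ofReal (absMonoSq 0 z * (1 - nrm2 z ^ 2) ^ α) = 1 := by
    rw [← lintegral_wBergman hcα (continuous_absMonoSq _).measurable (absMonoSq_nonneg _)]
    simpa [absMonoSq] using hprob
  rw [lintegral_wBergman hcα (continuous_absMonoSq _).measurable (absMonoSq_nonneg _)]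
  set L0 := ∫⁻ z in Ball n, ENNReal.ofReal (absMonoSq 0 z * (1 - nrm2 z ^ 2) ^ α)
  set L := ∫⁻ z in Ball n, ENNReal.ofReal (absMonoSq a z * (1 - nrm2 z ^ 2) ^ α)
  have hL0 : L0 ≠ ⊤ := by
    intro h
    rw [h, ENNReal.mul_top (by simpa using hcα)] at hp
    simp at hp
  have hL : L ≠ ⊤ := by
    intro h
    rw [h, ENNReal.mul_top (by simpa using hGa)] at h1
    simp at h1
  have e0 := congrArg ENNReal.toReal h0
  have e1 := congrArg ENNReal.toReal h1
  have e2 := congrArg ENNReal.toReal hp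
  simp only [Pi.zero_apply, Nat.cast_zero, Finset.sum_const_zero, add_zero, Nat.factorial_zero,
    Nat.cast_one, Finset.prod_const_one, mul_one, ENNReal.toReal_mul, ENNReal.toReal_one] at e0 e1 e2
  rw [ENNReal.toReal_ofReal (by positivity), ENNReal.toReal_ofReal (by positivity)] at e0
  rw [ENNReal.toReal_ofReal (by positivity), ENNReal.toReal_ofReal (by positivity)] at e1
  rw [ENNReal.toReal_ofReal (by positivity)] at e2
  rw [← ENNReal.ofReal_toReal hL, ← ENNReal.ofReal_mul hcα.le]
  congr 1
  rw [eq_div_iff hGa.ne']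
  have hL0' : L0.toReal ≠ 0 := by
    intro h; rw [h] at e2; simp at e2
  have : cα = 1 / L0.toReal := by field_simp; exact e2
  rw [this]
  have hG' := hG.ne'
  field_simp
  linear_combination e1 - (∏ i, ((a i).factorial : ℝ)) * e0

lemma lintegral_one_sub_rpow_wBergman_lt_top {n : ℕ} {α cα ε : ℝ} (hcα : 0 < cα)
    (hε : -1 < α - ε) :
    ∫⁻ z, ENNReal.ofReal ((Ball n).indicator (fun z => (1 - nrm2 z ^ 2) ^ (-ε)) z)
      ∂(wBergman n α cα) < ⊤ := by
  rw [lintegral_wBergman hcα]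
  · have h1 := lintegral_Ball_absMonoSq hε (0 : Fin n → ℕ)
    have hG : 0 < Real.Gamma (n + 1 + (α - ε) + ∑ i, ((0 : Fin n → ℕ) i : ℝ)) := by
      have : (0 : ℝ) ≤ n := by positivity
      exact Real.Gamma_pos_of_pos (by simp; linarith)
    have hL : ∫⁻ z in Ball n, ENNReal.ofReal (absMonoSq 0 z * (1 - nrm2 z ^ 2) ^ (α - ε)) ≠ ⊤ := by
      intro h
      rw [h, ENNReal.mul_top (by simpa using hG)] at h1
      simp at h1
    refine ENNReal.mul_lt_top ENNReal.ofReal_lt_top (lt_of_le_of_lt (le_of_eq ?_) hL.lt_top)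
    refine setLIntegral_congr_fun (measurableSet_Ball n) fun z hz => ?_
    have hz' := (mem_Ball_iff z).1 hz
    simp only [Set.indicator_of_mem hz]
    rw [← Real.rpow_add (by linarith)]
    simp only [absMonoSq, Pi.zero_apply, mul_zero, pow_zero, Finset.prod_const_one, one_mul]
    congr 2; ring
  · exact (((continuous_nrm2.pow 2).measurable.const_sub 1).pow_const (-ε)).indicator
      (measurableSet_Ball n)
  · intro z
    refine Set.indicator_nonneg (fun z hz => ?_) z
    have hz' := (mem_Ball_iff z).1 hz
    exact Real.rpow_nonneg (by linarith) _

lemma nrm2_mul_of_norm_eq_one {n : ℕ} {u : Fin n → ℂ} (hu : ∀ i, ‖u i‖ = 1) (z : Fin n → ℂ) :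
    nrm2 (fun i => u i * z i) = nrm2 z := by
  simp [nrm2, hu]

lemma mul_mem_Ball_iff {n : ℕ} {u : Fin n → ℂ} (hu : ∀ i, ‖u i‖ = 1) (z : Fin n → ℂ) :
    (fun i => u i * z i) ∈ Ball n ↔ z ∈ Ball n := by
  simp [Ball, nrm2_mul_of_norm_eq_one hu]

/-- The weighted measure is invariant under the torus action. -/
lemma measurePreserving_mul_wBergman (n : ℕ) (α cα : ℝ) {u : Fin n → ℂ} (hu : ∀ i, ‖u i‖ = 1) :
    MeasurePreserving (fun (z : Fin n → ℂ) i => u i * z i) (wBergman n α cα)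
      (wBergman n α cα) := by
  have h1 : ∀ i, MeasurePreserving (fun x : ℂ => u i * x) := fun i =>
    (rotation (⟨u i, by simp [Submonoid.unitSphere, hu i]⟩ : Circle)).measurePreserving
  have h2 : MeasurePreserving (fun (z : Fin n → ℂ) i => u i * z i) := volume_preserving_pi h1
  refine ⟨h2.measurable, ?_⟩
  ext A hA
  rw [Measure.map_apply h2.measurable hA, wBergman, withDensity_apply _ (h2.measurable hA),
    withDensity_apply _ hA, Measure.restrict_restrict hA,
    Measure.restrict_restrict (h2.measurable hA),
    ← h2.setLIntegral_comp_preimage (hA.inter (measurableSet_Ball n))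
      (measurable_wBergman_density n α cα)]
  have : (fun (z : Fin n → ℂ) i => u i * z i) ⁻¹' (A ∩ Ball n) =
      (fun (z : Fin n → ℂ) i => u i * z i) ⁻¹' A ∩ Ball n := by
    ext z; simp [mul_mem_Ball_iff hu]
  rw [this]
  simp only [nrm2_mul_of_norm_eq_one hu]

lemma integral_comp_mul_wBergman {n : ℕ} (α cα : ℝ) {u : Fin n → ℂ} (hu : ∀ i, ‖u i‖ = 1)
    {F : (Fin n → ℂ) → ℂ} (hF : AEStronglyMeasurable F (wBergman n α cα)) :
    ∫ z, F (fun i => u i * z i) ∂(wBergman n α cα) = ∫ z, F z ∂(wBergman n α cα) := by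
  have h := measurePreserving_mul_wBergman n α cα hu
  conv_rhs => rw [← h.map_eq]
  rw [integral_map h.measurable.aemeasurable]
  rwa [h.map_eq]

lemma integrable_wBergman_of_bound {n : ℕ} {α cα : ℝ} [IsProbabilityMeasure (wBergman n α cα)]
    {F : (Fin n → ℂ) → ℂ} (hF : AEStronglyMeasurable F (wBergman n α cα)) (C : ℝ)
    (hC : ∀ z ∈ Ball n, ‖F z‖ ≤ C) : Integrable F (wBergman n α cα) :=
  Integrable.of_bound hF C ((ae_mem_Ball n α cα).mono hC)

/-- The monomial `z ^ a`. -/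
def mono {n : ℕ} (a : Fin n → ℕ) (z : Fin n → ℂ) : ℂ := ∏ i, z i ^ a i

lemma continuous_mono {n : ℕ} (a : Fin n → ℕ) : Continuous (mono a) := by
  unfold mono; fun_prop

lemma norm_apply_le_one {n : ℕ} {z : Fin n → ℂ} (hz : z ∈ Ball n) (i : Fin n) : ‖z i‖ ≤ 1 := by
  rw [mem_Ball_iff, nrm2_sq] at hz
  have := Finset.single_le_sum (f := fun i => ‖z i‖ ^ 2) (fun _ _ => sq_nonneg _)
    (Finset.mem_univ i)
  exact (sq_le_one_iff₀ (norm_nonneg _)).1 (this.trans hz.le)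

lemma norm_mono_le_one {n : ℕ} (a : Fin n → ℕ) {z : Fin n → ℂ} (hz : z ∈ Ball n) :
    ‖mono a z‖ ≤ 1 := by
  rw [mono, norm_prod]
  refine Finset.prod_le_one (fun _ _ => norm_nonneg _) fun i _ => ?_
  rw [norm_pow]
  exact pow_le_one₀ (norm_nonneg _) (norm_apply_le_one hz i)

lemma integrable_conj_mono_mul_mono {n : ℕ} {α cα : ℝ} [IsProbabilityMeasure (wBergman n α cα)]
    (a b : Fin n → ℕ) :
    Integrable (fun z => (starRingEnd ℂ) (mono a z) * mono b z) (wBergman n α cα) := by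
  refine integrable_wBergman_of_bound ?_ 1 fun z hz => ?_
  · exact ((Complex.continuous_conj.comp (continuous_mono a)).mul
      (continuous_mono b)).aestronglyMeasurable
  · rw [norm_mul, RCLike.norm_conj]
    exact mul_le_one₀ (norm_mono_le_one a hz) (norm_nonneg _) (norm_mono_le_one b hz)

lemma integral_conj_mono_mul_mono_of_ne {n : ℕ} {α cα : ℝ} {a b : Fin n → ℕ} (hab : a ≠ b) :
    ∫ z, (starRingEnd ℂ) (mono a z) * mono b z ∂(wBergman n α cα) = 0 := by
  obtain ⟨j, hj⟩ := Function.ne_iff.1 hab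
  have hj' : (b j : ℝ) - a j ≠ 0 := by
    rw [sub_ne_zero]; exact_mod_cast hj.symm
  set θ : ℝ := Real.pi / (b j - a j) with hθ
  let u : Fin n → ℂ := Function.update 1 j (Complex.exp (θ * Complex.I))
  have hu : ∀ i, ‖u i‖ = 1 := by
    intro i
    by_cases h : i = j
    · subst h; simp [u, Complex.norm_exp_ofReal_mul_I]
    · simp [u, h]
  have hmono : ∀ c z, mono c (fun i => u i * z i) =
      Complex.exp (θ * Complex.I) ^ c j * mono c z := by
    intro c z
    simp only [mono, mul_pow, Finset.prod_mul_distrib]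
    congr 1
    rw [Finset.prod_eq_single j]
    · simp [u]
    · intro i _ h; simp [u, h]
    · simp
  have hunit : (starRingEnd ℂ) (Complex.exp (θ * Complex.I)) ^ a j *
      Complex.exp (θ * Complex.I) ^ b j = -1 := by
    rw [← Complex.exp_conj, ← Complex.exp_nat_mul, ← Complex.exp_nat_mul, ← Complex.exp_add,
      ← Complex.exp_pi_mul_I]
    congr 1
    have hj'' : (b j : ℂ) - a j ≠ 0 := by exact_mod_cast hj'
    simp only [hθ, map_mul, Complex.conj_ofReal, Complex.conj_I]
    push_cast
    field_simp
    ring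
  have h := integral_comp_mul_wBergman α cα hu
    (F := fun z => (starRingEnd ℂ) (mono a z) * mono b z)
    ((Complex.continuous_conj.comp (continuous_mono a)).mul
      (continuous_mono b)).aestronglyMeasurable
  have h2 : ∀ z, (starRingEnd ℂ) (mono a (fun i => u i * z i)) * mono b (fun i => u i * z i) =
      - ((starRingEnd ℂ) (mono a z) * mono b z) := by
    intro z
    rw [hmono, hmono, map_mul, map_pow]
    linear_combination ((starRingEnd ℂ) (mono a z) * mono b z) * hunit
  simp_rw [h2] at h
  rw [integral_neg] at h
  exact self_eq_neg.1 h.symm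

lemma integral_conj_mono_mul_mono_self {n : ℕ} {α cα : ℝ} (hα : -1 < α) (hcα : 0 < cα)
    (hprob : wBergman n α cα Set.univ = 1) (a : Fin n → ℕ) :
    ∫ z, (starRingEnd ℂ) (mono a z) * mono a z ∂(wBergman n α cα) =
      (((∏ i, ((a i).factorial : ℝ)) * Real.Gamma (n + 1 + α) /
        Real.Gamma (n + 1 + α + ∑ i, (a i : ℝ)) : ℝ) : ℂ) := by
  have h : ∀ z : Fin n → ℂ, (starRingEnd ℂ) (mono a z) * mono a z = (absMonoSq a z : ℂ) := by
    intro z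
    rw [Complex.conj_mul', mono, norm_prod, absMonoSq]
    push_cast
    rw [← Finset.prod_pow]
    refine Finset.prod_congr rfl fun i _ => ?_
    rw [norm_pow, Complex.ofReal_pow, ← pow_mul, mul_comm]
  have hs : 0 < (n : ℝ) + 1 + α := by
    have : (0 : ℝ) ≤ n := by positivity
    linarith
  have hG : 0 < Real.Gamma (n + 1 + α) := Real.Gamma_pos_of_pos hs
  have hGa : 0 < Real.Gamma (n + 1 + α + ∑ i, (a i : ℝ)) :=
    Real.Gamma_pos_of_pos (by positivity)
  simp_rw [h]
  rw [integral_complex_ofReal, integral_eq_lintegral_of_nonneg_ae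
    (Filter.Eventually.of_forall (absMonoSq_nonneg a))
    (continuous_absMonoSq a).aestronglyMeasurable,
    lintegral_absMonoSq_wBergman hα hcα hprob, ENNReal.toReal_ofReal (by positivity)]

lemma pairC_pow {n : ℕ} (z w : Fin n → ℂ) (k : ℕ) :
    pairC z w ^ k = ∑ a ∈ Finset.piAntidiag Finset.univ k,
      (Nat.multinomial Finset.univ a : ℂ) * (mono a z * (starRingEnd ℂ) (mono a w)) := by
  rw [pairC, Finset.sum_pow_eq_sum_piAntidiag]
  refine Finset.sum_congr rfl fun a _ => ?_
  simp [mono, mul_pow, Finset.prod_mul_distrib]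

lemma integral_pairC_pow_mul_mono {n : ℕ} {α cα : ℝ} (hα : -1 < α) (hcα : 0 < cα)
    (hprob : wBergman n α cα Set.univ = 1) (z : Fin n → ℂ) (k : ℕ) (b : Fin n → ℕ) :
    ∫ w, pairC z w ^ k * mono b w ∂(wBergman n α cα) =
      if k = ∑ i, b i then (momentCoeff (n + 1 + α) k : ℂ) * mono b z else 0 := by
  have : IsProbabilityMeasure (wBergman n α cα) := ⟨hprob⟩
  have h : ∀ w, pairC z w ^ k * mono b w = ∑ a ∈ Finset.piAntidiag Finset.univ k,
      ((Nat.multinomial Finset.univ a : ℂ) * mono a z) *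
        ((starRingEnd ℂ) (mono a w) * mono b w) := by
    intro w
    rw [pairC_pow, Finset.sum_mul]
    exact Finset.sum_congr rfl fun a _ => by ring
  simp_rw [h]
  rw [integral_finsetSum _ fun a _ => (integrable_conj_mono_mul_mono a b).const_mul _]
  simp_rw [integral_const_mul]
  split_ifs with hk
  · rw [Finset.sum_eq_single b]
    · rw [integral_conj_mono_mul_mono_self hα hcα hprob]
      have hm := Nat.multinomial_spec Finset.univ b
      rw [← hk] at hm
      have hm' : (∏ i, ((b i).factorial : ℂ)) * (Nat.multinomial Finset.univ b : ℂ) =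
        (k.factorial : ℂ) := by exact_mod_cast hm
      rw [momentCoeff, ← Nat.cast_sum, ← hk]
      push_cast
      rw [← hm']
      ring
    · intro a _ hab
      rw [integral_conj_mono_mul_mono_of_ne hab, mul_zero]
    · intro hb
      exact absurd (by simp [Finset.mem_piAntidiag, hk]) hb
  · refine Finset.sum_eq_zero fun a ha => ?_
    rw [integral_conj_mono_mul_mono_of_ne, mul_zero]
    rintro rfl
    exact hk (by simpa using (Finset.mem_piAntidiag.1 ha).1.symm)

lemma norm_pairC_le {n : ℕ} (z w : Fin n → ℂ) : ‖pairC z w‖ ≤ nrm2 z * nrm2 w := by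
  refine (norm_sum_le _ _).trans ?_
  simp only [norm_mul, RCLike.norm_conj]
  exact Real.sum_mul_le_sqrt_mul_sqrt _ _ _

lemma continuous_pairC {n : ℕ} :
    Continuous fun x : (Fin n → ℂ) × (Fin n → ℂ) => pairC x.1 x.2 := by
  unfold pairC
  fun_prop

lemma pairC_self {n : ℕ} (z : Fin n → ℂ) : pairC z z = ((nrm2 z ^ 2 : ℝ) : ℂ) := by
  rw [pairC, nrm2_sq]
  push_cast
  exact Finset.sum_congr rfl fun i _ => Complex.mul_conj' _

lemma conj_pairC {n : ℕ} (z w : Fin n → ℂ) : (starRingEnd ℂ) (pairC z w) = pairC w z := by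
  simp [pairC, mul_comm]

lemma integral_pairC_pow_mul_pairC_pow {n : ℕ} {α cα : ℝ} (hα : -1 < α) (hcα : 0 < cα)
    (hprob : wBergman n α cα Set.univ = 1) (w : Fin n → ℂ) (k l : ℕ) :
    ∫ z, pairC w z ^ k * pairC z w ^ l ∂(wBergman n α cα) =
      if k = l then (momentCoeff (n + 1 + α) k : ℂ) * ((nrm2 w ^ 2 : ℝ) : ℂ) ^ k else 0 := by
  have : IsProbabilityMeasure (wBergman n α cα) := ⟨hprob⟩
  have h : ∀ z, pairC w z ^ k * pairC z w ^ l = ∑ a ∈ Finset.piAntidiag Finset.univ l,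
      ((Nat.multinomial Finset.univ a : ℂ) * (starRingEnd ℂ) (mono a w)) *
        (pairC w z ^ k * mono a z) := by
    intro z
    rw [pairC_pow z, Finset.mul_sum]
    exact Finset.sum_congr rfl fun a _ => by ring
  simp_rw [h]
  rw [integral_finsetSum]
  · simp_rw [integral_const_mul, integral_pairC_pow_mul_mono hα hcα hprob]
    have hsum : ∀ a ∈ Finset.piAntidiag (Finset.univ : Finset (Fin n)) l, ∑ i, a i = l :=
      fun a ha => (Finset.mem_piAntidiag.1 ha).1
    rw [Finset.sum_congr rfl fun a ha => by rw [hsum a ha]]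
    split_ifs with hk
    · rw [← pairC_self, hk, pairC_pow, Finset.mul_sum]
      exact Finset.sum_congr rfl fun a _ => by ring
    · simp
  · intro a _
    refine Integrable.const_mul ?_ _
    refine integrable_wBergman_of_bound ?_ (nrm2 w ^ k) fun z hz => ?_
    · refine Continuous.aestronglyMeasurable (Continuous.mul (Continuous.pow ?_ k) (continuous_mono a))
      exact continuous_pairC.comp (continuous_const.prodMk continuous_id)
    · rw [norm_mul, norm_pow]
      have h1 : ‖pairC w z‖ ≤ nrm2 w := (norm_pairC_le w z).trans
        (mul_le_of_le_one_right (nrm2_nonneg w) (le_of_lt hz))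
      calc _ ≤ nrm2 w ^ k * 1 := mul_le_mul (pow_le_pow_left₀ (norm_nonneg _) h1 k)
            (norm_mono_le_one a hz) (norm_nonneg _) (pow_nonneg (nrm2_nonneg w) k)
        _ = _ := mul_one _

lemma circleMap_mul_mem_Ball_iff {n : ℕ} (θ : ℝ) (w : Fin n → ℂ) :
    (fun i => circleMap 0 1 θ * w i) ∈ Ball n ↔ w ∈ Ball n :=
  mul_mem_Ball_iff (u := fun _ => circleMap 0 1 θ) (by simp) w

/-- Mean value property on circles through a point of the ball. -/
lemma integral_circleMap_mul {n : ℕ} {h : (Fin n → ℂ) → ℂ} (hh : DifferentiableOn ℂ h (Ball n))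
    {w : Fin n → ℂ} (hw : w ∈ Ball n) :
    ∫ θ in (0 : ℝ)..2 * Real.pi, h (fun i => circleMap 0 1 θ * w i) = 2 * Real.pi * h 0 := by
  have hd : DifferentiableOn ℂ (fun c : ℂ => h (fun i => c * w i)) (Metric.closedBall 0 1) := by
    refine hh.comp (f := fun (c : ℂ) i => c * w i) (by fun_prop) fun c hc => ?_
    rw [mem_Ball_iff, nrm2_sq] at *
    simp only [norm_mul, mul_pow, ← Finset.mul_sum]
    have hc' : ‖c‖ ^ 2 ≤ 1 := by
      rw [sq_le_one_iff₀ (norm_nonneg _)]; simpa using hc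
    have : (0 : ℝ) ≤ ∑ i, ‖w i‖ ^ 2 := by positivity
    nlinarith
  have hc : DiffContOnCl ℂ (fun c : ℂ => h (fun i => c * w i)) (Metric.ball 0 |1|) := by
    rw [abs_one]
    refine DifferentiableOn.diffContOnCl ?_
    rwa [closure_ball _ one_ne_zero]
  have := hc.circleAverage
  rw [Real.circleAverage_def, inv_smul_eq_iff₀ (by positivity)] at this
  rw [this]
  simp only [zero_mul, Complex.real_smul]
  push_cast
  rfl

/-- The mean value property for the weighted measure. -/
lemma integral_wBergman_eq_apply_zero {n : ℕ} {α cα : ℝ}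
    (hprob : wBergman n α cα Set.univ = 1) {h : (Fin n → ℂ) → ℂ}
    (hh : DifferentiableOn ℂ h (Ball n)) (hi : Integrable h (wBergman n α cα)) :
    ∫ w, h w ∂(wBergman n α cα) = h 0 := by
  have : IsProbabilityMeasure (wBergman n α cα) := ⟨hprob⟩
  set μ := wBergman n α cα
  set h' := (Ball n).indicator h with hh'
  have hae : h' =ᵐ[μ] h := (ae_mem_Ball n α cα).mono fun w hw => Set.indicator_of_mem hw h
  have hm : Measurable h' := by
    classical
    rw [hh', ← Set.piecewise_eq_indicator]
    exact hh.continuousOn.measurable_piecewise continuousOn_const (measurableSet_Ball n)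
  have hi' : Integrable h' μ := hi.congr hae.symm
  have hmp : ∀ θ : ℝ, MeasurePreserving (fun (w : Fin n → ℂ) i => circleMap 0 1 θ * w i) μ μ :=
    fun θ => measurePreserving_mul_wBergman n α cα (u := fun _ => circleMap 0 1 θ) (by simp)
  have hF : Measurable (fun x : ℝ × (Fin n → ℂ) => h' (fun i => circleMap 0 1 x.1 * x.2 i)) := by
    refine hm.comp (Continuous.measurable ?_)
    fun_prop
  have hInt : Integrable (Function.uncurry fun (θ : ℝ) (w : Fin n → ℂ) =>
      h' (fun i => circleMap 0 1 θ * w i))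
      ((volume.restrict (Set.uIoc 0 (2 * Real.pi))).prod μ) := by
    refine (integrable_prod_iff (by exact hF.aestronglyMeasurable)).2 ⟨Filter.Eventually.of_forall fun θ => (hmp θ).integrable_comp_of_integrable hi', ?_⟩
    have : ∀ θ : ℝ, ∫ w, ‖h' (fun i => circleMap 0 1 θ * w i)‖ ∂μ = ∫ w, ‖h' w‖ ∂μ := by
      intro θ
      conv_rhs => rw [← (hmp θ).map_eq]
      rw [integral_map (hmp θ).measurable.aemeasurable hm.norm.aestronglyMeasurable]
    simp only [Function.uncurry_apply_pair, this]
    have : IsFiniteMeasure (volume.restrict (Set.uIoc 0 (2 * Real.pi))) := by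
      rw [Set.uIoc]; infer_instance
    exact integrable_const _
  have hswap := intervalIntegral_integral_swap hInt
  have h1 : ∀ θ : ℝ, ∫ w, h' (fun i => circleMap 0 1 θ * w i) ∂μ = ∫ w, h' w ∂μ := fun θ =>
    integral_comp_mul_wBergman α cα (u := fun _ => circleMap 0 1 θ) (by simp)
      hm.aestronglyMeasurable
  have h2 : ∀ᵐ w ∂μ, ∫ θ in (0 : ℝ)..2 * Real.pi, h' (fun i => circleMap 0 1 θ * w i) =
      2 * Real.pi * h 0 := by
    filter_upwards [ae_mem_Ball n α cα] with w hw
    rw [← integral_circleMap_mul hh hw]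
    congr with θ
    exact Set.indicator_of_mem ((circleMap_mul_mem_Ball_iff θ w).2 hw) h
  rw [integral_congr_ae h2] at hswap
  simp only [h1, intervalIntegral.integral_const, sub_zero, integral_const, probReal_univ,
    one_smul, Complex.real_smul, Complex.ofReal_mul, Complex.ofReal_ofNat] at hswap
  rw [← integral_congr_ae hae]
  have hpi : (2 * Real.pi : ℂ) ≠ 0 := by simp [Real.pi_ne_zero]
  exact mul_left_cancel₀ hpi hswap

/-- The Taylor coefficients of `(1 - x)⁻ˢ`. -/
def kernelCoeff (s : ℝ) (k : ℕ) : ℝ := Real.Gamma (s + k) / (Real.Gamma s * k.factorial)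

lemma kernelCoeff_pos {s : ℝ} (hs : 0 < s) (k : ℕ) : 0 < kernelCoeff s k := by
  have h1 : 0 < Real.Gamma s := Real.Gamma_pos_of_pos hs
  have h2 : 0 < Real.Gamma (s + k) := Real.Gamma_pos_of_pos (by positivity)
  unfold kernelCoeff
  positivity

lemma choose_eq_kernelCoeff {s : ℝ} (hs : 0 < s) (k : ℕ) :
    Ring.choose ((s : ℂ) + k - 1) k = (kernelCoeff s k : ℂ) := by
  have h0 : Real.Gamma s ≠ 0 := (Real.Gamma_pos_of_pos hs).ne'
  have h : ∀ k : ℕ, (k.factorial : ℂ) * Ring.multichoose (s : ℂ) k =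
      ((Real.Gamma (s + k) / Real.Gamma s : ℝ) : ℂ) := by
    intro k
    rw [← nsmul_eq_mul, Ring.factorial_nsmul_multichoose_eq_ascPochhammer,
      Polynomial.ascPochhammer_smeval_eq_eval]
    induction k with
    | zero => simp [h0]
    | succ k ih =>
      rw [ascPochhammer_succ_eval, ih, Nat.cast_succ, ← add_assoc,
        Real.Gamma_add_one (by positivity)]
      push_cast
      ring
  have hf : (k.factorial : ℂ) ≠ 0 := by exact_mod_cast k.factorial_ne_zero
  rw [Ring.choose, show (s : ℂ) + k - 1 - k + 1 = s by ring]
  apply mul_left_cancel₀ hf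
  rw [h, kernelCoeff]
  have hf' : (k.factorial : ℝ) ≠ 0 := by exact_mod_cast k.factorial_ne_zero
  norm_cast
  field_simp

lemma hasSum_kernelCoeff {s : ℝ} (hs : 0 < s) {x : ℂ} (hx : ‖x‖ < 1) :
    HasSum (fun k => (kernelCoeff s k : ℂ) * x ^ k) ((1 - x) ^ (s : ℂ))⁻¹ := by
  have h := (Complex.one_div_one_sub_cpow_hasFPowerSeriesOnBall_zero (s : ℂ)).hasSum
    (y := x) (by simpa [enorm_eq_nnnorm, ← NNReal.coe_lt_one] using hx)
  simp only [zero_add, FormalMultilinearSeries.ofScalars_apply_eq, choose_eq_kernelCoeff hs,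
    one_div, smul_eq_mul] at h
  exact h

lemma summable_kernelCoeff {s : ℝ} (hs : 0 < s) {r : ℝ} (hr0 : 0 ≤ r) (hr : r < 1) :
    Summable fun k => kernelCoeff s k * r ^ k := by
  have h := (hasSum_kernelCoeff hs (x := (r : ℂ)) (by simpa [abs_of_nonneg hr0])).summable
  exact_mod_cast h

lemma kernelCoeff_mul_momentCoeff {s : ℝ} (hs : 0 < s) (k : ℕ) :
    kernelCoeff s k * momentCoeff s k = 1 := by
  have h1 : Real.Gamma s ≠ 0 := (Real.Gamma_pos_of_pos hs).ne'
  have h2 : Real.Gamma (s + k) ≠ 0 := (Real.Gamma_pos_of_pos (by positivity)).ne'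
  have hf' : (k.factorial : ℝ) ≠ 0 := by exact_mod_cast k.factorial_ne_zero
  unfold kernelCoeff momentCoeff
  field_simp

lemma kernelCoeff_sq_mul_momentCoeff_le {s : ℝ} (hs : 0 < s) (k : ℕ) :
    kernelCoeff (s / 2) (k + 1) ^ 2 * momentCoeff s (k + 1) ≤
      Real.Gamma s / Real.Gamma (s / 2) ^ 2 * (1 / (k + 1)) := by
  have hc := Real.Gamma_mul_add_mul_le_rpow_Gamma_mul_rpow_Gamma (s := (k : ℝ) + 1)
    (t := s + (k + 1)) (a := 1 / 2) (b := 1 / 2) (by positivity) (by positivity)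
    (by norm_num) (by norm_num) (by norm_num)
  rw [show 1 / 2 * ((k : ℝ) + 1) + 1 / 2 * (s + (k + 1)) = s / 2 + (k + 1) by ring,
    ← Real.sqrt_eq_rpow, ← Real.sqrt_eq_rpow] at hc
  have p1 : 0 < Real.Gamma s := Real.Gamma_pos_of_pos hs
  have p2 : 0 < Real.Gamma (s / 2) := Real.Gamma_pos_of_pos (by positivity)
  have p3 : 0 < Real.Gamma (s + (k + 1)) := Real.Gamma_pos_of_pos (by positivity)
  have p4 : 0 < Real.Gamma (s / 2 + (k + 1)) := Real.Gamma_pos_of_pos (by positivity)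
  have hsq : Real.Gamma (s / 2 + (k + 1)) ^ 2 ≤ k.factorial * Real.Gamma (s + (k + 1)) := by
    refine (pow_le_pow_left₀ p4.le hc 2).trans (le_of_eq ?_)
    rw [mul_pow, Real.sq_sqrt (Real.Gamma_pos_of_pos (by positivity)).le, Real.sq_sqrt p3.le,
      Real.Gamma_nat_eq_factorial]
  have hk : (0 : ℝ) < k.factorial := by positivity
  unfold kernelCoeff momentCoeff
  rw [Nat.factorial_succ]
  push_cast
  calc _ = Real.Gamma s / Real.Gamma (s / 2) ^ 2 * (1 / (k + 1)) *
        (Real.Gamma (s / 2 + (k + 1)) ^ 2 / (k.factorial * Real.Gamma (s + (k + 1)))) := by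
        field_simp
    _ ≤ _ := mul_le_of_le_one_right (by positivity) ((div_le_one (by positivity)).2 hsq)

lemma integral_norm_sq_partialSum {n : ℕ} {α cα : ℝ} (hα : -1 < α) (hcα : 0 < cα)
    (hprob : wBergman n α cα Set.univ = 1) {w : Fin n → ℂ} (b : ℕ → ℝ) (M : ℕ) :
    ∫ z, ‖∑ k ∈ Finset.range M, (b k : ℂ) * pairC z w ^ k‖ ^ 2 ∂(wBergman n α cα) =
      ∑ k ∈ Finset.range M, b k ^ 2 * momentCoeff (n + 1 + α) k * (nrm2 w ^ 2) ^ k := by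
  have : IsProbabilityMeasure (wBergman n α cα) := ⟨hprob⟩
  apply Complex.ofReal_injective
  rw [← integral_complex_ofReal]
  have h : ∀ z, ((‖∑ k ∈ Finset.range M, (b k : ℂ) * pairC z w ^ k‖ ^ 2 : ℝ) : ℂ) =
      ∑ k ∈ Finset.range M, ∑ l ∈ Finset.range M,
        ((b k : ℂ) * b l) * (pairC w z ^ k * pairC z w ^ l) := by
    intro z
    rw [Complex.ofReal_pow, ← Complex.conj_mul', map_sum, Finset.sum_mul_sum]
    refine Finset.sum_congr rfl fun k _ => Finset.sum_congr rfl fun l _ => ?_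
    rw [map_mul, map_pow, conj_pairC, Complex.conj_ofReal]
    ring
  have c1 : Continuous fun z : Fin n → ℂ => pairC w z :=
    continuous_pairC.comp (continuous_const.prodMk continuous_id)
  have c2 : Continuous fun z : Fin n → ℂ => pairC z w :=
    continuous_pairC.comp (continuous_id.prodMk continuous_const)
  have hInt : ∀ k l : ℕ, Integrable (fun z => pairC w z ^ k * pairC z w ^ l)
      (wBergman n α cα) := by
    intro k l
    refine integrable_wBergman_of_bound ((c1.pow k).mul (c2.pow l)).aestronglyMeasurable
      (nrm2 w ^ k * nrm2 w ^ l) fun z hz => ?_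
    have hz' : nrm2 z ≤ 1 := le_of_lt hz
    rw [norm_mul, norm_pow, norm_pow]
    have h1 := (norm_pairC_le w z).trans (mul_le_of_le_one_right (nrm2_nonneg w) hz')
    have h2 := (norm_pairC_le z w).trans (mul_le_of_le_one_left (nrm2_nonneg w) hz')
    have := nrm2_nonneg w
    gcongr
  simp_rw [h]
  rw [integral_finsetSum _ fun k _ => integrable_finsetSum _ fun l _ => (hInt k l).const_mul _]
  push_cast
  refine Finset.sum_congr rfl fun k hk => ?_
  rw [integral_finsetSum _ fun l _ => (hInt k l).const_mul _]
  simp_rw [integral_const_mul, integral_pairC_pow_mul_pairC_pow hα hcα hprob]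
  rw [Finset.sum_eq_single k]
  · simp; ring
  · intro l _ hl
    rw [if_neg (Ne.symm hl), mul_zero]
  · intro h; exact absurd hk h

/-- The Bergman kernel. -/
def bergmanKernel {n : ℕ} (s : ℝ) (z w : Fin n → ℂ) : ℂ := ((1 - pairC z w) ^ (s : ℂ))⁻¹

lemma sum_range_coeff_le {s r : ℝ} (hs : 0 < s) (hr0 : 0 ≤ r) (hr : r < 1) (M : ℕ) :
    ∑ k ∈ Finset.range M, kernelCoeff (s / 2) k ^ 2 * momentCoeff s k * r ^ k ≤
      1 + Real.Gamma s / Real.Gamma (s / 2) ^ 2 * -Real.log (1 - r) := by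
  have p1 : 0 < Real.Gamma s := Real.Gamma_pos_of_pos hs
  have p2 : 0 < Real.Gamma (s / 2) := Real.Gamma_pos_of_pos (by positivity)
  have hlog := Real.hasSum_pow_div_log_of_abs_lt_one (x := r) (by rwa [abs_of_nonneg hr0])
  have hnn : 0 ≤ -Real.log (1 - r) := hlog.nonneg fun k => by positivity
  cases M with
  | zero =>
    rw [Finset.sum_range_zero]
    positivity
  | succ M =>
    rw [Finset.sum_range_succ', add_comm]
    refine add_le_add (le_of_eq ?_) ?_
    · simp [kernelCoeff, momentCoeff, p1.ne', p2.ne']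
    · refine le_trans ?_ (mul_le_mul_of_nonneg_left
        (sum_le_hasSum (Finset.range M) (fun k _ => by positivity) hlog) (by positivity))
      rw [Finset.mul_sum]
      refine Finset.sum_le_sum fun k _ => ?_
      refine (mul_le_mul_of_nonneg_right (kernelCoeff_sq_mul_momentCoeff_le hs k)
        (by positivity)).trans (le_of_eq ?_)
      ring

lemma norm_pairC_lt_one {n : ℕ} {z w : Fin n → ℂ} (hz : z ∈ Ball n) (hw : w ∈ Ball n) :
    ‖pairC z w‖ < 1 :=
  (norm_pairC_le z w).trans_lt (mul_lt_one_of_nonneg_of_lt_one_left (nrm2_nonneg z) hz (le_of_lt hw))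

lemma measurable_bergmanKernel {n : ℕ} (s : ℝ) :
    Measurable fun x : (Fin n → ℂ) × (Fin n → ℂ) => bergmanKernel s x.1 x.2 :=
  ((continuous_pairC.measurable.const_sub 1).pow_const _).inv

/-- Logarithmic Forelli-Rudin estimate. -/
lemma lintegral_bergmanKernel_le_log {n : ℕ} {α cα : ℝ} (hα : -1 < α) (hcα : 0 < cα)
    (hprob : wBergman n α cα Set.univ = 1) {w : Fin n → ℂ} (hw : w ∈ Ball n) :
    ∫⁻ z, ENNReal.ofReal ‖bergmanKernel (n + 1 + α) z w‖ ∂(wBergman n α cα) ≤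
      ENNReal.ofReal (1 + Real.Gamma (n + 1 + α) / Real.Gamma ((n + 1 + α) / 2) ^ 2 *
        -Real.log (1 - nrm2 w ^ 2)) := by
  have : IsProbabilityMeasure (wBergman n α cα) := ⟨hprob⟩
  have hs : 0 < (n : ℝ) + 1 + α := by
    have : (0 : ℝ) ≤ n := by positivity
    linarith
  set s : ℝ := n + 1 + α
  set S : ℕ → (Fin n → ℂ) → ℂ := fun M z =>
    ∑ k ∈ Finset.range M, (kernelCoeff (s / 2) k : ℂ) * pairC z w ^ k
  have c2 : Continuous fun z : Fin n → ℂ => pairC z w :=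
    continuous_pairC.comp (continuous_id.prodMk continuous_const)
  have hSc : ∀ M, Continuous (S M) := fun M => by
    refine continuous_finsetSum _ fun k _ => continuous_const.mul (c2.pow k)
  have hlim : ∀ z ∈ Ball n, Filter.Tendsto (fun M => ENNReal.ofReal (‖S M z‖ ^ 2)) Filter.atTop
      (nhds (ENNReal.ofReal ‖bergmanKernel s z w‖)) := by
    intro z hz
    have hx := norm_pairC_lt_one hz hw
    have ht := (hasSum_kernelCoeff (half_pos hs) hx).tendsto_sum_nat
    have heq : ‖bergmanKernel s z w‖ = ‖((1 - pairC z w) ^ ((s / 2 : ℝ) : ℂ))⁻¹‖ ^ 2 := by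
      have hne : 1 - pairC z w ≠ 0 := by
        intro h0
        rw [sub_eq_zero] at h0
        rw [← h0] at hx
        simp at hx
      rw [bergmanKernel, ← norm_pow, inv_pow, sq, ← Complex.cpow_add _ _ hne]
      congr 3
      push_cast; ring
    rw [heq]
    exact (ENNReal.continuous_ofReal.tendsto _).comp (ht.norm.pow 2)
  have hcalc : ∀ M, ∫⁻ z, ENNReal.ofReal (‖S M z‖ ^ 2) ∂(wBergman n α cα) ≤
      ENNReal.ofReal (1 + Real.Gamma s / Real.Gamma (s / 2) ^ 2 *
        -Real.log (1 - nrm2 w ^ 2)) := by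
    intro M
    have hi : Integrable (fun z => ‖S M z‖ ^ 2) (wBergman n α cα) := by
      refine Integrable.of_bound ((hSc M).norm.pow 2).aestronglyMeasurable
        ((∑ k ∈ Finset.range M, |kernelCoeff (s / 2) k|) ^ 2) ((ae_mem_Ball n α cα).mono ?_)
      intro z hz
      rw [Real.norm_of_nonneg (by positivity)]
      refine pow_le_pow_left₀ (norm_nonneg _) ((norm_sum_le _ _).trans ?_) 2
      refine Finset.sum_le_sum fun k _ => ?_
      rw [norm_mul, norm_pow, Complex.norm_real, Real.norm_eq_abs]
      exact mul_le_of_le_one_right (abs_nonneg _)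
        (pow_le_one₀ (norm_nonneg _) (norm_pairC_lt_one hz hw).le)
    rw [← ofReal_integral_eq_lintegral_ofReal hi
      (Filter.Eventually.of_forall fun z => by positivity),
      integral_norm_sq_partialSum hα hcα hprob]
    exact ENNReal.ofReal_le_ofReal
      (sum_range_coeff_le hs (sq_nonneg _) ((mem_Ball_iff w).1 hw) M)
  calc _ = ∫⁻ z, Filter.liminf (fun M => ENNReal.ofReal (‖S M z‖ ^ 2)) Filter.atTop
        ∂(wBergman n α cα) :=
        lintegral_congr_ae ((ae_mem_Ball n α cα).mono fun z hz => (hlim z hz).liminf_eq.symm)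
    _ ≤ Filter.liminf (fun M => ∫⁻ z, ENNReal.ofReal (‖S M z‖ ^ 2) ∂(wBergman n α cα))
        Filter.atTop := lintegral_liminf_le fun M => ((hSc M).norm.pow 2).measurable.ennreal_ofReal
    _ ≤ _ := Filter.liminf_le_of_frequently_le' (Filter.Frequently.of_forall hcalc)

lemma lintegral_bergmanKernel_le {n : ℕ} {α cα : ℝ} (hα : -1 < α) (hcα : 0 < cα)
    (hprob : wBergman n α cα Set.univ = 1) {ε : ℝ} (hε : 0 < ε) :
    ∃ D : ℝ, 0 < D ∧ ∀ w ∈ Ball n,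
      ∫⁻ z, ENNReal.ofReal ‖bergmanKernel (n + 1 + α) z w‖ ∂(wBergman n α cα) ≤
        ENNReal.ofReal (D * (1 - nrm2 w ^ 2) ^ (-ε)) := by
  have hs : 0 < (n : ℝ) + 1 + α := by
    have : (0 : ℝ) ≤ n := by positivity
    linarith
  have p1 : 0 < Real.Gamma (n + 1 + α) := Real.Gamma_pos_of_pos hs
  have p2 : 0 < Real.Gamma ((n + 1 + α) / 2) := Real.Gamma_pos_of_pos (by positivity)
  refine ⟨1 + Real.Gamma (n + 1 + α) / Real.Gamma ((n + 1 + α) / 2) ^ 2 / ε, by positivity,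
    fun w hw => (lintegral_bergmanKernel_le_log hα hcα hprob hw).trans
      (ENNReal.ofReal_le_ofReal ?_)⟩
  have hw' := (mem_Ball_iff w).1 hw
  have hx : 0 < 1 - nrm2 w ^ 2 := by linarith
  have hx1 : 1 - nrm2 w ^ 2 ≤ 1 := by linarith [sq_nonneg (nrm2 w)]
  have h1 := Real.log_le_rpow_div (inv_nonneg.2 hx.le) hε
  rw [Real.log_inv, Real.inv_rpow hx.le, ← Real.rpow_neg hx.le] at h1
  have h2 : 1 ≤ (1 - nrm2 w ^ 2) ^ (-ε) :=
    Real.one_le_rpow_of_pos_of_le_one_of_nonpos hx hx1 (by linarith)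
  have hC : 0 < Real.Gamma (n + 1 + α) / Real.Gamma ((n + 1 + α) / 2) ^ 2 := by positivity
  calc _ ≤ (1 - nrm2 w ^ 2) ^ (-ε) + Real.Gamma (n + 1 + α) / Real.Gamma ((n + 1 + α) / 2) ^ 2 *
        ((1 - nrm2 w ^ 2) ^ (-ε) / ε) := add_le_add h2 (mul_le_mul_of_nonneg_left h1 hC.le)
    _ = _ := by ring

lemma norm_bergmanKernel_le {n : ℕ} {s : ℝ} (hs : 0 < s) {r : ℝ} (hr0 : 0 ≤ r) (hr : r < 1)
    {z w : Fin n → ℂ} (h : ‖pairC z w‖ ≤ r) :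
    ‖bergmanKernel s z w‖ ≤ ∑' k, kernelCoeff s k * r ^ k := by
  have h1 := hasSum_kernelCoeff hs (h.trans_lt hr)
  rw [bergmanKernel, ← h1.tsum_eq]
  refine tsum_of_norm_bounded (summable_kernelCoeff hs hr0 hr).hasSum fun k => ?_
  rw [norm_mul, norm_pow, Complex.norm_real, Real.norm_of_nonneg (kernelCoeff_pos hs k).le]
  have := (kernelCoeff_pos hs k).le
  gcongr

lemma norm_pairC_le_left {n : ℕ} (z : Fin n → ℂ) {w : Fin n → ℂ} (hw : w ∈ Ball n) :
    ‖pairC z w‖ ≤ nrm2 z :=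
  (norm_pairC_le z w).trans (mul_le_of_le_one_right (nrm2_nonneg z) (le_of_lt hw))

lemma norm_pairC_le_right {n : ℕ} {z : Fin n → ℂ} (w : Fin n → ℂ) (hz : z ∈ Ball n) :
    ‖pairC z w‖ ≤ nrm2 w :=
  (norm_pairC_le z w).trans (mul_le_of_le_one_left (nrm2_nonneg w) (le_of_lt hz))

lemma integrable_bergmanKernel_mul {n : ℕ} {α cα s : ℝ} (hs : 0 < s) {z : Fin n → ℂ}
    (hz : z ∈ Ball n) {u : (Fin n → ℂ) → ℂ} (hu : Integrable u (wBergman n α cα)) :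
    Integrable (fun w => bergmanKernel s z w * u w) (wBergman n α cα) := by
  refine hu.bdd_mul (c := ∑' k, kernelCoeff s k * nrm2 z ^ k)
    (measurable_bergmanKernel s).of_uncurry_left.aestronglyMeasurable ?_
  filter_upwards [ae_mem_Ball n α cα] with w hw
  exact norm_bergmanKernel_le hs (nrm2_nonneg z) hz (norm_pairC_le_left z hw)

/-- The reproducing property for monomials. -/
lemma integral_bergmanKernel_mul_mono {n : ℕ} {α cα : ℝ} (hα : -1 < α) (hcα : 0 < cα)
    (hprob : wBergman n α cα Set.univ = 1) {z : Fin n → ℂ} (hz : z ∈ Ball n) (b : Fin n → ℕ) :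
    ∫ w, bergmanKernel (n + 1 + α) z w * mono b w ∂(wBergman n α cα) = mono b z := by
  have : IsProbabilityMeasure (wBergman n α cα) := ⟨hprob⟩
  have hs : 0 < (n : ℝ) + 1 + α := by
    have : (0 : ℝ) ≤ n := by positivity
    linarith
  set s : ℝ := n + 1 + α with hsdef
  have c1 : Continuous fun w : Fin n → ℂ => pairC z w :=
    continuous_pairC.comp (continuous_const.prodMk continuous_id)
  have h := hasSum_integral_of_dominated_convergence (μ := wBergman n α cα)
    (F := fun (k : ℕ) w => (kernelCoeff s k : ℂ) * pairC z w ^ k * mono b w)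
    (f := fun w => bergmanKernel s z w * mono b w)
    (fun k _ => kernelCoeff s k * nrm2 z ^ k)
    (fun k => ((continuous_const.mul (c1.pow k)).mul (continuous_mono b)).aestronglyMeasurable)
    (fun k => by
      filter_upwards [ae_mem_Ball n α cα] with w hw
      have h0 := (kernelCoeff_pos hs k).le
      have h1 := norm_pairC_le_left z hw
      have h2 := norm_mono_le_one b hw
      rw [norm_mul, norm_mul, norm_pow, Complex.norm_real, Real.norm_of_nonneg h0]
      refine (mul_le_of_le_one_right (by positivity) h2).trans ?_
      gcongr)
    (Filter.Eventually.of_forall fun _ => summable_kernelCoeff hs (nrm2_nonneg z) hz)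
    (integrable_const _)
    (by
      filter_upwards [ae_mem_Ball n α cα] with w hw
      exact (hasSum_kernelCoeff hs (norm_pairC_lt_one hz hw)).mul_right _)
  refine h.unique ?_
  have h3 : ∀ k, ∫ w, (kernelCoeff s k : ℂ) * pairC z w ^ k * mono b w ∂(wBergman n α cα) =
      if k = ∑ i, b i then mono b z else 0 := by
    intro k
    simp_rw [mul_assoc]
    rw [integral_const_mul, integral_pairC_pow_mul_mono hα hcα hprob]
    split_ifs
    · rw [← mul_assoc, ← Complex.ofReal_mul, kernelCoeff_mul_momentCoeff hs]
      simp
    · simp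
  simp_rw [h3]
  exact hasSum_ite_eq _ _

lemma eval_eq_sum_mono {n : ℕ} (P : MvPolynomial (Fin n) ℂ) (w : Fin n → ℂ) :
    MvPolynomial.eval w P = ∑ d ∈ P.support, P.coeff d * mono d w :=
  MvPolynomial.eval_eq' w P

lemma norm_eval_le {n : ℕ} (P : MvPolynomial (Fin n) ℂ) {w : Fin n → ℂ} (hw : w ∈ Ball n) :
    ‖MvPolynomial.eval w P‖ ≤ ∑ d ∈ P.support, ‖P.coeff d‖ := by
  rw [eval_eq_sum_mono]
  refine (norm_sum_le _ _).trans (Finset.sum_le_sum fun d _ => ?_)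
  rw [norm_mul]
  exact mul_le_of_le_one_right (norm_nonneg _) (norm_mono_le_one _ hw)

lemma integrable_eval {n : ℕ} {α cα : ℝ} (hprob : wBergman n α cα Set.univ = 1)
    (P : MvPolynomial (Fin n) ℂ) :
    Integrable (fun w => MvPolynomial.eval w P) (wBergman n α cα) := by
  have : IsProbabilityMeasure (wBergman n α cα) := ⟨hprob⟩
  exact integrable_wBergman_of_bound (MvPolynomial.continuous_eval P).aestronglyMeasurable _
    fun w hw => norm_eval_le P hw

/-- The reproducing property for polynomials. -/
lemma integral_bergmanKernel_mul_eval {n : ℕ} {α cα : ℝ} (hα : -1 < α) (hcα : 0 < cα)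
    (hprob : wBergman n α cα Set.univ = 1) {z : Fin n → ℂ} (hz : z ∈ Ball n)
    (P : MvPolynomial (Fin n) ℂ) :
    ∫ w, bergmanKernel (n + 1 + α) z w * MvPolynomial.eval w P ∂(wBergman n α cα) =
      MvPolynomial.eval z P := by
  have : IsProbabilityMeasure (wBergman n α cα) := ⟨hprob⟩
  have hs : 0 < (n : ℝ) + 1 + α := by
    have : (0 : ℝ) ≤ n := by positivity
    linarith
  have h : ∀ w, bergmanKernel (n + 1 + α) z w * MvPolynomial.eval w P =
      ∑ d ∈ P.support, P.coeff d * (bergmanKernel (n + 1 + α) z w * mono d w) := by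
    intro w
    rw [eval_eq_sum_mono, Finset.mul_sum]
    exact Finset.sum_congr rfl fun d _ => by ring
  simp_rw [h]
  rw [integral_finsetSum, eval_eq_sum_mono]
  · simp_rw [integral_const_mul, integral_bergmanKernel_mul_mono hα hcα hprob hz]
  · intro d _
    refine (integrable_bergmanKernel_mul hs hz ?_).const_mul _
    exact integrable_wBergman_of_bound (continuous_mono d).aestronglyMeasurable 1
      fun w hw => norm_mono_le_one d hw

lemma differentiableOn_bergmanKernel {n : ℕ} (s : ℝ) {w : Fin n → ℂ} (hw : w ∈ Ball n) :
    DifferentiableOn ℂ (fun z => bergmanKernel s z w) (Ball n) := by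
  intro z hz
  have hslit : 1 - pairC z w ∈ Complex.slitPlane := by
    rw [sub_eq_add_neg]
    exact Complex.mem_slitPlane_of_norm_lt_one (by rw [norm_neg]; exact norm_pairC_lt_one hz hw)
  have hd : DifferentiableAt ℂ (fun z => pairC z w) z := by
    unfold pairC; fun_prop
  refine DifferentiableAt.differentiableWithinAt ?_
  unfold bergmanKernel
  refine DifferentiableAt.inv ((hd.const_sub 1).cpow_const hslit) ?_
  rw [Complex.cpow_ne_zero_iff]
  exact Or.inl (Complex.slitPlane_ne_zero hslit)

lemma integrable_bergmanKernel_left {n : ℕ} {α cα s : ℝ} (hs : 0 < s)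
    (hprob : wBergman n α cα Set.univ = 1) {w : Fin n → ℂ} (hw : w ∈ Ball n) :
    Integrable (fun z => bergmanKernel s z w) (wBergman n α cα) := by
  have : IsProbabilityMeasure (wBergman n α cα) := ⟨hprob⟩
  exact integrable_wBergman_of_bound (measurable_bergmanKernel s).of_uncurry_right.aestronglyMeasurable
    _ fun z hz => norm_bergmanKernel_le hs (nrm2_nonneg w) hw (norm_pairC_le_right w hz)

lemma integral_bergmanKernel_left {n : ℕ} {α cα s : ℝ} (hs : 0 < s)
    (hprob : wBergman n α cα Set.univ = 1) {w : Fin n → ℂ} (hw : w ∈ Ball n) :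
    ∫ z, bergmanKernel s z w ∂(wBergman n α cα) = 1 := by
  rw [integral_wBergman_eq_apply_zero hprob (differentiableOn_bergmanKernel s hw)
    (integrable_bergmanKernel_left hs hprob hw)]
  simp [bergmanKernel, pairC]

lemma integrable_prod_bergmanKernel {n : ℕ} {α cα : ℝ} (hα : -1 < α) (hcα : 0 < cα)
    (hprob : wBergman n α cα Set.univ = 1) {ε : ℝ} (hε : 0 < ε) {u : (Fin n → ℂ) → ℂ}
    (hu : AEStronglyMeasurable u (wBergman n α cα))
    (hfin : ∫⁻ w, ENNReal.ofReal (‖u w‖ * (1 - nrm2 w ^ 2) ^ (-ε)) ∂(wBergman n α cα) < ⊤) :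
    Integrable (Function.uncurry fun z w => bergmanKernel (n + 1 + α) z w * u w)
      ((wBergman n α cα).prod (wBergman n α cα)) := by
  have : IsProbabilityMeasure (wBergman n α cα) := ⟨hprob⟩
  obtain ⟨D, hD, hK⟩ := lintegral_bergmanKernel_le hα hcα hprob hε
  have hm : AEStronglyMeasurable
      (Function.uncurry fun z w => bergmanKernel (n + 1 + α) z w * u w)
      ((wBergman n α cα).prod (wBergman n α cα)) :=
    (measurable_bergmanKernel (n + 1 + α)).aestronglyMeasurable.mul hu.comp_snd
  refine ⟨hm, ?_⟩
  rw [HasFiniteIntegral, lintegral_prod_symm _ hm.enorm]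
  have hle : ∀ᵐ w ∂(wBergman n α cα),
      ∫⁻ z, ‖Function.uncurry (fun z w => bergmanKernel (n + 1 + α) z w * u w) (z, w)‖ₑ
        ∂(wBergman n α cα) ≤
      ENNReal.ofReal D * ENNReal.ofReal (‖u w‖ * (1 - nrm2 w ^ 2) ^ (-ε)) := by
    filter_upwards [ae_mem_Ball n α cα] with w hw
    simp only [Function.uncurry_apply_pair, enorm_mul]
    rw [lintegral_mul_const' _ _ enorm_ne_top]
    simp_rw [← ofReal_norm]
    refine (mul_le_mul_left (hK w hw) _).trans (le_of_eq ?_)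
    have hw' := (mem_Ball_iff w).1 hw
    have : 0 ≤ (1 - nrm2 w ^ 2) ^ (-ε) := Real.rpow_nonneg (by linarith) _
    rw [← ENNReal.ofReal_mul (by positivity), ← ENNReal.ofReal_mul hD.le]
    congr 1; ring
  refine (lintegral_mono_ae hle).trans_lt ?_
  rw [lintegral_const_mul' _ _ ENNReal.ofReal_ne_top]
  exact ENNReal.mul_lt_top ENNReal.ofReal_lt_top hfin

lemma lintegral_norm_mul_rpow_lt_top {n : ℕ} {α cα p q : ℝ} (hα : -1 < α) (hcα : 0 < cα)
    (hpq : p.HolderConjugate q) {h : (Fin n → ℂ) → ℂ}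
    (hh : Integrable (fun z => ‖h z‖ ^ p) (wBergman n α cα)) :
    ∫⁻ w, ENNReal.ofReal (‖h w‖ * (1 - nrm2 w ^ 2) ^ (-((1 + α) / (2 * q))))
      ∂(wBergman n α cα) < ⊤ := by
  have hq : 1 < q := hpq.symm.lt
  have hp : 1 < p := hpq.lt
  set ε := (1 + α) / (2 * q) with hε
  have hεq : ε * q = (1 + α) / 2 := by rw [hε]; field_simp
  have hle : ∀ᵐ w ∂(wBergman n α cα), ENNReal.ofReal (‖h w‖ * (1 - nrm2 w ^ 2) ^ (-ε)) ≤
      ENNReal.ofReal (‖h w‖ ^ p) +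
      ENNReal.ofReal ((Ball n).indicator (fun z => (1 - nrm2 z ^ 2) ^ (-((1 + α) / 2))) w) := by
    filter_upwards [ae_mem_Ball n α cα] with w hw
    have hw' := (mem_Ball_iff w).1 hw
    have hx : 0 < 1 - nrm2 w ^ 2 := by linarith
    rw [Set.indicator_of_mem hw, ← ENNReal.ofReal_add (by positivity) (by positivity)]
    refine ENNReal.ofReal_le_ofReal ?_
    have hy := Real.young_inequality_of_nonneg (norm_nonneg (h w))
      (Real.rpow_nonneg hx.le (-ε)) hpq
    rw [← Real.rpow_mul hx.le, neg_mul, hεq] at hy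
    refine hy.trans (add_le_add (div_le_self (by positivity) hp.le)
      (div_le_self (by positivity) hq.le))
  refine (lintegral_mono_ae hle).trans_lt ?_
  rw [lintegral_add_left' hh.aestronglyMeasurable.aemeasurable.ennreal_ofReal]
  refine ENNReal.add_lt_top.2 ⟨?_, lintegral_one_sub_rpow_wBergman_lt_top hcα (by linarith)⟩
  exact hh.lintegral_lt_top

lemma MemAp.aestronglyMeasurable_apply {n d : ℕ} {α p cα : ℝ} {h : (Fin n → ℂ) → Fin d → ℂ}
    (hh : MemAp n d α p cα h) (i : Fin d) :
    AEStronglyMeasurable (fun z => h z i) (wBergman n α cα) := by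
  have h1 : ContinuousOn (fun z => h z i) (Ball n) :=
    (differentiableOn_pi.1 hh.1 i).continuousOn
  exact (h1.aestronglyMeasurable (measurableSet_Ball n)).mono_ac
    (withDensity_absolutelyContinuous _ _)

lemma MemAp.integrable_norm_rpow {n d : ℕ} {α p cα : ℝ} {h : (Fin n → ℂ) → Fin d → ℂ}
    (hh : MemAp n d α p cα h) (i : Fin d) :
    Integrable (fun z => ‖h z i‖ ^ p) (wBergman n α cα) := by
  refine hh.2.mono' ((hh.aestronglyMeasurable_apply i).norm.aemeasurable.pow_const p).aestronglyMeasurable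
    (Filter.Eventually.of_forall fun z => ?_)
  rw [Real.norm_of_nonneg (by positivity)]
  exact Finset.single_le_sum (f := fun i => ‖h z i‖ ^ p) (fun _ _ => by positivity)
    (Finset.mem_univ i)

lemma MemAp.integrable_apply {n d : ℕ} {α p cα : ℝ} (hp : 1 < p)
    (hprob : wBergman n α cα Set.univ = 1) {h : (Fin n → ℂ) → Fin d → ℂ}
    (hh : MemAp n d α p cα h) (i : Fin d) :
    Integrable (fun z => h z i) (wBergman n α cα) := by
  have : IsProbabilityMeasure (wBergman n α cα) := ⟨hprob⟩
  refine ((integrable_const (1 : ℝ)).add (hh.integrable_norm_rpow i)).mono'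
    (hh.aestronglyMeasurable_apply i) (Filter.Eventually.of_forall fun z => ?_)
  have h0 : 0 ≤ ‖h z i‖ ^ p := by positivity
  rcases le_total ‖h z i‖ 1 with h1 | h1
  · simp only [Pi.add_apply]; linarith
  · have := Real.self_le_rpow_of_one_le h1 hp.le
    simp only [Pi.add_apply]; linarith

lemma ToepSym_diagonal_apply {n d : ℕ} {α cα : ℝ} (hα : -1 < α) {c h : (Fin n → ℂ) → Fin d → ℂ}
    (hi : ∀ i, Integrable (fun w => c w i * h w i) (wBergman n α cα)) {z : Fin n → ℂ}
    (hz : z ∈ Ball n) (i : Fin d) :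
    ToepSym α cα (fun w => Matrix.diagonal (c w)) h z i =
      ∫ w, bergmanKernel (n + 1 + α) z w * (c w i * h w i) ∂(wBergman n α cα) := by
  have hs : 0 < (n : ℝ) + 1 + α := by
    have : (0 : ℝ) ≤ n := by positivity
    linarith
  have h1 : ∀ w j, (((1 - pairC z w) ^ (((n + 1 + α : ℝ)) : ℂ))⁻¹ •
      (Matrix.diagonal (c w)).mulVec (h w)) j =
      bergmanKernel (n + 1 + α) z w * (c w j * h w j) := by
    intro w j
    rw [Pi.smul_apply, Matrix.mulVec_diagonal, smul_eq_mul, bergmanKernel]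
  rw [ToepSym, Bproj, eval_integral]
  · simp_rw [h1]
  · intro j
    simp_rw [h1]
    exact integrable_bergmanKernel_mul hs hz (hi j)

/-- Rank-one factorization through Toeplitz operators: for polynomials
`f`, `g`, the rank-one operator `(f ⊗ g)(h) = ⟨h, g⟩_{A²_α} f` equals
`T_{f̃} ∘ (𝟏⊗𝟏) ∘ T_{g̃*}` on `A^p_α`, where `f̃` is the diagonal matrix symbol
with `f` on the diagonal and `g̃*` its conjugate analogue for `g`; moreover
`𝟏⊗𝟏 = T_{δ₀ W}`, the Toeplitz operator with symbol the point mass at `0`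
times the all-ones matrix `W`, i.e.
`T_{δ₀W} h(z) = (1-⟨z,0⟩)^{-(n+1+α)} W h(0)`. -/
theorem rank_one_factorization
    (n d : ℕ) (α p q cα : ℝ)
    (hα : -1 < α) (hp : 1 < p) (hpq : 1 / p + 1 / q = 1) (hcα : 0 < cα)
    (hprob : wBergman n α cα Set.univ = 1)
    (f g : (Fin n → ℂ) → Fin d → ℂ) (hf : IsPolyMap f) (hg : IsPolyMap g) :
    (∀ h, MemAp n d α p cα h → ∀ z ∈ Ball n,
      ToepSym α cα (fun w => Matrix.diagonal (f w))
        (oneTensorOne n d α cα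
          (ToepSym α cα
            (fun w => Matrix.diagonal (fun i => (starRingEnd ℂ) (g w i))) h))
        z =
      (∫ w, einner (h w) (g w) ∂(wBergman n α cα)) • f z) ∧
    (∀ h, MemAp n d α p cα h → ∀ z ∈ Ball n,
      oneTensorOne n d α cα h z =
        ((1 - pairC z 0) ^ (((n + 1 + α : ℝ)) : ℂ))⁻¹ •
          (Matrix.of fun _ _ => (1 : ℂ)).mulVec (h 0)) := by
  have hprobI : IsProbabilityMeasure (wBergman n α cα) := ⟨hprob⟩
  have hs : 0 < (n : ℝ) + 1 + α := by
    have : (0 : ℝ) ≤ n := by positivity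
    linarith
  have hconj : p.HolderConjugate q := by
    rw [Real.holderConjugate_iff]
    exact ⟨hp, by simpa using hpq⟩
  choose Pf hPf using hf
  choose Pg hPg using hg
  refine ⟨fun h hh z hz => ?_, fun h hh z _ => ?_⟩
  · set u : Fin d → (Fin n → ℂ) → ℂ := fun i w => (starRingEnd ℂ) (g w i) * h w i with hu
    have hgm : ∀ i, Continuous fun w => (starRingEnd ℂ) (g w i) := fun i => by
      simp_rw [hPg]
      exact Complex.continuous_conj.comp (MvPolynomial.continuous_eval (Pg i))
    have hgb : ∀ i, ∀ w ∈ Ball n,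
        ‖(starRingEnd ℂ) (g w i)‖ ≤ ∑ e ∈ (Pg i).support, ‖(Pg i).coeff e‖ := fun i w hw => by
      rw [RCLike.norm_conj, hPg]
      exact norm_eval_le _ hw
    have hui : ∀ i, Integrable (u i) (wBergman n α cα) := fun i =>
      (hh.integrable_apply hp hprob i).bdd_mul (hgm i).aestronglyMeasurable
        ((ae_mem_Ball n α cα).mono (hgb i))
    have hq : 0 < q := hconj.symm.pos
    have hup : ∀ i, Integrable
        (Function.uncurry fun z w => bergmanKernel (n + 1 + α) z w * u i w)
        ((wBergman n α cα).prod (wBergman n α cα)) := fun i => by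
      refine integrable_prod_bergmanKernel hα hcα hprob (ε := (1 + α) / (2 * q))
        (by have : 0 < 1 + α := by linarith
            positivity) (hui i).aestronglyMeasurable ?_
      refine lt_of_le_of_lt (lintegral_mono_ae
        (g := fun w => ENNReal.ofReal (∑ e ∈ (Pg i).support, ‖(Pg i).coeff e‖) *
          ENNReal.ofReal (‖h w i‖ * (1 - nrm2 w ^ 2) ^ (-((1 + α) / (2 * q))))) ?_) ?_
      · filter_upwards [ae_mem_Ball n α cα] with w hw
        have hw' := (mem_Ball_iff w).1 hw
        have : 0 ≤ (1 - nrm2 w ^ 2) ^ (-((1 + α) / (2 * q))) := Real.rpow_nonneg (by linarith) _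
        rw [← ENNReal.ofReal_mul (Finset.sum_nonneg fun _ _ => norm_nonneg _), ← mul_assoc]
        refine ENNReal.ofReal_le_ofReal (mul_le_mul_of_nonneg_right ?_ this)
        rw [norm_mul]
        exact mul_le_mul_of_nonneg_right (hgb i w hw) (norm_nonneg _)
      · rw [lintegral_const_mul' _ _ ENNReal.ofReal_ne_top]
        exact ENNReal.mul_lt_top ENNReal.ofReal_lt_top
          (lintegral_norm_mul_rpow_lt_top hα hcα hconj (hh.integrable_norm_rpow i))
    have hc : ∫ w, einner (ToepSym α cα
        (fun w => Matrix.diagonal (fun i => (starRingEnd ℂ) (g w i))) h w) (onesV d)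
          ∂(wBergman n α cα) = ∫ w, einner (h w) (g w) ∂(wBergman n α cα) := by
      have h1 : ∀ᵐ z ∂(wBergman n α cα), einner (ToepSym α cα
          (fun w => Matrix.diagonal (fun i => (starRingEnd ℂ) (g w i))) h z) (onesV d) =
          ∑ i, ∫ w, bergmanKernel (n + 1 + α) z w * u i w ∂(wBergman n α cα) := by
        filter_upwards [ae_mem_Ball n α cα] with z hz
        simp only [einner, onesV, map_one, mul_one]
        exact Finset.sum_congr rfl fun i _ =>
          ToepSym_diagonal_apply hα (c := fun w i => (starRingEnd ℂ) (g w i)) hui hz i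
      have h2 : ∀ w, einner (h w) (g w) = ∑ i, u i w := fun w =>
        Finset.sum_congr rfl fun i _ => mul_comm _ _
      have h3 : ∀ i, Integrable (fun z => ∫ w, bergmanKernel (n + 1 + α) z w * u i w
          ∂(wBergman n α cα)) (wBergman n α cα) := fun i => (hup i).integral_prod_left
      rw [integral_congr_ae h1, integral_finsetSum _ fun i _ => h3 i]
      simp_rw [h2]
      rw [integral_finsetSum _ fun i _ => hui i]
      refine Finset.sum_congr rfl fun i _ => ?_
      rw [integral_integral_swap (hup i)]
      refine integral_congr_ae ?_
      filter_upwards [ae_mem_Ball n α cα] with w hw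
      rw [integral_mul_const, integral_bergmanKernel_left hs hprob hw, one_mul]
    ext i
    unfold oneTensorOne
    rw [hc]
    set C := ∫ w, einner (h w) (g w) ∂(wBergman n α cα)
    rw [ToepSym_diagonal_apply hα (fun j => ?_) hz]
    · simp only [Pi.smul_apply, onesV, smul_eq_mul, mul_one, hPf]
      simp_rw [← mul_assoc]
      rw [integral_mul_const, integral_bergmanKernel_mul_eval hα hcα hprob hz, mul_comm]
    · simp only [hPf]
      exact (integrable_eval hprob (Pf j)).mul_const _
  · ext j
    have h1 : ∀ w, einner (h w) (onesV d) = ∑ i, h w i := fun w => by simp [einner, onesV]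
    unfold oneTensorOne
    simp_rw [h1]
    rw [integral_finsetSum _ fun i _ => hh.integrable_apply hp hprob i]
    have h2 : ∀ i, ∫ w, h w i ∂(wBergman n α cα) = h 0 i := fun i =>
      integral_wBergman_eq_apply_zero hprob (differentiableOn_pi.1 hh.1 i)
        (hh.integrable_apply hp hprob i)
    simp [h2, onesV, pairC, Matrix.mulVec, dotProduct]
end
end
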